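/- arXiv:1506.03188 — 13 statements merged into one kernel-verified Lean document; each statement's English description precedes it below -/
import Mathlib

section
/- Let M = Γ(K,v) be an (H,u)-perfect pseudo MV-algebra with (H,u)-decomposition (M_t : t ∈ [0,u]_H). If a ∈ M_s and b ∈ M_t with s + t < u, then the partial sum a + b is defined in M (i.e. a + b ≤ v in K) and a + b ∈ M_{s+t}. If a ∈ M_s, b ∈ M_t and a + b is defined in M, then s + t ≤ u; and if moreover s + t = u, then a + b ∈ M_u. -/
open Pointwise

/-- `v` is a strong (order) unit of an ordered group: `v ≥ 0` and every element is
dominated by some positive multiple of `v`. -/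
def IsStrongOrderUnit {G : Type*} [AddMonoid G] [PartialOrder G] (v : G) : Prop :=
  0 ≤ v ∧ ∀ g : G, ∃ n : ℕ, 0 < n ∧ g ≤ n • v

section Decomposition

variable {H : Type*} [AddGroup H] [LinearOrder H]
  [CovariantClass H H (· + ·) (· ≤ ·)]
  [CovariantClass H H (Function.swap (· + ·)) (· ≤ ·)]
variable {K : Type*} [AddGroup K] [Lattice K]
  [CovariantClass K K (· + ·) (· ≤ ·)]
  [CovariantClass K K (Function.swap (· + ·)) (· ≤ ·)]

/-- An `(H,u)`-decomposition of the pseudo MV-algebra `M = Γ(K,v)`: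
a family `(Mt t : t ∈ [0,u]_H)` of nonempty, pairwise disjoint subsets of `[0,v]`
covering `[0,v]` such that (a) `Mt s ≤ Mt t` for `s < t`;
(b) `(Mt t)⁻ = Mt (u - t)` and `(Mt t)∼ = Mt (-t + u)` (here `x⁻ = v - x`, `x∼ = -x + v`);
(c) `x ⊕ y = (x + y) ⊓ v ∈ Mt (min (s+t) u)` whenever `x ∈ Mt s`, `y ∈ Mt t`. -/
structure IsHuDecomposition (u : H) (v : K) (Mt : H → Set K) : Prop where
  nonempty : ∀ t ∈ Set.Icc (0 : H) u, (Mt t).Nonempty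
  subset_carrier : ∀ t ∈ Set.Icc (0 : H) u, Mt t ⊆ Set.Icc (0 : K) v
  pairwise_disjoint : ∀ s ∈ Set.Icc (0 : H) u, ∀ t ∈ Set.Icc (0 : H) u,
    s ≠ t → Disjoint (Mt s) (Mt t)
  cover : ∀ x ∈ Set.Icc (0 : K) v, ∃ t ∈ Set.Icc (0 : H) u, x ∈ Mt t
  le_of_lt : ∀ s ∈ Set.Icc (0 : H) u, ∀ t ∈ Set.Icc (0 : H) u, s < t →
    ∀ a ∈ Mt s, ∀ b ∈ Mt t, a ≤ b
  compl_image : ∀ t ∈ Set.Icc (0 : H) u, (fun x => v - x) '' Mt t = Mt (u - t)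
  sim_image : ∀ t ∈ Set.Icc (0 : H) u, (fun x => -x + v) '' Mt t = Mt (-t + u)
  oplus_mem : ∀ s ∈ Set.Icc (0 : H) u, ∀ t ∈ Set.Icc (0 : H) u,
    ∀ x ∈ Mt s, ∀ y ∈ Mt t, (x + y) ⊓ v ∈ Mt (min (s + t) u)

/-- In an `(H,u)`-perfect pseudo MV-algebra `M = Γ(K,v)` with
`(H,u)`-decomposition `(Mt t : t ∈ [0,u]_H)`: if `a ∈ Mt s`, `b ∈ Mt t` and `s + t < u`,
then `a + b` is defined in `M` (i.e. `a + b ≤ v`) and `a + b ∈ Mt (s + t)`; if `a + b`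
is defined in `M` then `s + t ≤ u`; and if moreover `s + t = u` then `a + b ∈ Mt u`. -/
theorem statement_0 (u : H) (v : K) (hu : 0 < u)
    (hsuH : IsStrongOrderUnit u) (hsuK : IsStrongOrderUnit v)
    (Mt : H → Set K) (hdec : IsHuDecomposition u v Mt)
    (s t : H) (hs : s ∈ Set.Icc (0 : H) u) (ht : t ∈ Set.Icc (0 : H) u)
    (a b : K) (ha : a ∈ Mt s) (hb : b ∈ Mt t) :
    (s + t < u → a + b ≤ v ∧ a + b ∈ Mt (s + t)) ∧
    (a + b ≤ v → s + t ≤ u) ∧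
    (a + b ≤ v → s + t = u → a + b ∈ Mt u) := by
  have hut : u - t ∈ Set.Icc (0 : H) u :=
    ⟨sub_nonneg.2 ht.2, sub_le_self u ht.1⟩
  have hb' : v - b ∈ Mt (u - t) := by
    rw [← hdec.compl_image t ht]
    exact Set.mem_image_of_mem _ hb
  have hsum : a + b ≤ v → a + b ∈ Mt (min (s + t) u) := fun h => by
    have := hdec.oplus_mem s hs t ht a ha b hb
    rwa [inf_eq_left.2 h] at this
  refine ⟨fun h => ?_, fun h => ?_, fun h hst => ?_⟩
  · have hab : a + b ≤ v :=
      le_sub_iff_add_le.1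
        (hdec.le_of_lt s hs (u - t) hut (lt_sub_iff_add_lt.2 h) a ha (v - b) hb')
    exact ⟨hab, min_eq_left h.le ▸ hsum hab⟩
  · by_contra! hlt
    have hlt' : u - t < s := sub_lt_iff_lt_add.2 hlt
    have heq : a = v - b :=
      le_antisymm (le_sub_iff_add_le.2 h) (hdec.le_of_lt (u - t) hut s hs hlt' (v - b) hb' a ha)
    exact Set.disjoint_left.1 (hdec.pairwise_disjoint s hs (u - t) hut hlt'.ne') ha (heq ▸ hb')
  · simpa [hst] using hsum h
end Decomposition
end

section
/- Let M = Γ(K,v) be an (H,u)-perfect pseudo MV-algebra with (H,u)-decomposition (M_t : t ∈ [0,u]_H). If s + t < u, then M_s + M_t is defined in M (every sum a + b with a ∈ M_s and b ∈ M_t satisfies a + b ≤ v in K) and M_s + M_t = M_{s+t}; in particular, every z ∈ M_{s+t} can be written as z = a + b with a ∈ M_s and b ∈ M_t. -/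
open Pointwise

section Decomposition

variable {H : Type*} [AddGroup H] [LinearOrder H]
  [CovariantClass H H (· + ·) (· ≤ ·)]
  [CovariantClass H H (Function.swap (· + ·)) (· ≤ ·)]
variable {K : Type*} [AddGroup K] [Lattice K]
  [CovariantClass K K (· + ·) (· ≤ ·)]
  [CovariantClass K K (Function.swap (· + ·)) (· ≤ ·)]

/-- The least component of an `(H,u)`-decomposition contains `0`. -/
theorem IsHuDecomposition.zero_mem {u : H} {v : K} {Mt : H → Set K} (hu : 0 < u) (hv : 0 ≤ v)
    (hdec : IsHuDecomposition u v Mt) : (0 : K) ∈ Mt 0 := by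
  have h0 : (0 : H) ∈ Set.Icc (0 : H) u := ⟨le_rfl, hu.le⟩
  obtain ⟨r, hr, h0r⟩ := hdec.cover 0 ⟨le_rfl, hv⟩
  rcases hr.1.eq_or_lt with rfl | hlt
  · exact h0r
  · obtain ⟨x, hx⟩ := hdec.nonempty 0 h0
    have hx0 : x = 0 :=
      le_antisymm (hdec.le_of_lt 0 h0 r hr hlt x hx 0 h0r) (hdec.subset_carrier 0 h0 hx).1
    exact hx0 ▸ hx

/-- The index of the component containing a given element is unique. -/
theorem IsHuDecomposition.index_unique {u : H} {v : K} {Mt : H → Set K}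
    (hdec : IsHuDecomposition u v Mt) {s t : H} (hs : s ∈ Set.Icc (0 : H) u)
    (ht : t ∈ Set.Icc (0 : H) u) {x : K} (hxs : x ∈ Mt s) (hxt : x ∈ Mt t) : s = t := by
  by_contra hne
  exact Set.disjoint_left.mp (hdec.pairwise_disjoint s hs t ht hne) hxs hxt

/-- Elements of components whose indices add up to less than `u` are summable in `[0,v]`. -/
theorem IsHuDecomposition.add_le {u : H} {v : K} {Mt : H → Set K}
    (hdec : IsHuDecomposition u v Mt) {s t : H} (hs : s ∈ Set.Icc (0 : H) u)
    (ht : t ∈ Set.Icc (0 : H) u) (hst : s + t < u) {a b : K} (ha : a ∈ Mt s) (hb : b ∈ Mt t) :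
    a + b ≤ v := by
  have hcompl : v - b ∈ Mt (u - t) := hdec.compl_image t ht ▸ Set.mem_image_of_mem _ hb
  have hut : u - t ∈ Set.Icc (0 : H) u := ⟨sub_nonneg.mpr ht.2, sub_le_self u ht.1⟩
  exact le_sub_iff_add_le.mp
    (hdec.le_of_lt s hs (u - t) hut (lt_sub_iff_add_lt.mpr hst) a ha _ hcompl)

/-- Every element of the component of index `s + t < u` splits as a sum. -/
theorem IsHuDecomposition.exists_eq_add {u : H} {v : K} {Mt : H → Set K} (hu : 0 < u)
    (hv : 0 ≤ v) (hdec : IsHuDecomposition u v Mt) {s t : H} (hs : s ∈ Set.Icc (0 : H) u)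
    (ht : t ∈ Set.Icc (0 : H) u) (hst : s + t < u) {z : K} (hz : z ∈ Mt (s + t)) :
    ∃ a ∈ Mt s, ∃ b ∈ Mt t, z = a + b := by
  have hadd : s + t ∈ Set.Icc (0 : H) u := ⟨add_nonneg hs.1 ht.1, hst.le⟩
  rcases ht.1.eq_or_lt with rfl | htpos
  · exact ⟨z, by simpa using hz, 0, hdec.zero_mem hu hv, (add_zero z).symm⟩
  rcases hs.1.eq_or_lt with rfl | hspos
  · exact ⟨0, hdec.zero_mem hu hv, z, by simpa using hz, (zero_add z).symm⟩
  obtain ⟨a, ha⟩ := hdec.nonempty s hs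
  have haz : a ≤ z := hdec.le_of_lt s hs _ hadd (lt_add_of_pos_right s htpos) a ha z hz
  have hzv : z ≤ v := (hdec.subset_carrier _ hadd hz).2
  have hb : -a + z ∈ Set.Icc (0 : K) v := by
    refine ⟨le_neg_add_iff_add_le.mpr (by simpa using haz), neg_add_le_iff_le_add.mpr ?_⟩
    exact hzv.trans (le_add_of_nonneg_left (hdec.subset_carrier s hs ha).1)
  obtain ⟨r, hr, hbr⟩ := hdec.cover _ hb
  have hzr := hdec.oplus_mem s hs r hr a ha _ hbr
  rw [add_neg_cancel_left, inf_eq_left.mpr hzv] at hzr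
  have hidx : min (s + r) u = s + t :=
    hdec.index_unique ⟨le_min (add_nonneg hs.1 hr.1) hu.le, min_le_right _ _⟩ hadd hzr hz
  have hrt : r = t := by
    rcases min_choice (s + r) u with h | h
    · exact add_left_cancel (h.symm.trans hidx)
    · exact absurd (hidx.symm.trans h) hst.ne
  exact ⟨a, ha, -a + z, hrt ▸ hbr, (add_neg_cancel_left a z).symm⟩

/-- In an `(H,u)`-perfect pseudo MV-algebra `M = Γ(K,v)` with
`(H,u)`-decomposition `(Mt t)`: if `s + t < u` then `Mt s + Mt t` is defined in `M`
(every sum `a + b` with `a ∈ Mt s`, `b ∈ Mt t` satisfies `a + b ≤ v`) and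
`Mt s + Mt t = Mt (s + t)`; in particular every `z ∈ Mt (s + t)` can be written as
`z = a + b` with `a ∈ Mt s`, `b ∈ Mt t`. -/
theorem statement_1 (u : H) (v : K) (hu : 0 < u)
    (hsuH : IsStrongOrderUnit u) (hsuK : IsStrongOrderUnit v)
    (Mt : H → Set K) (hdec : IsHuDecomposition u v Mt)
    (s t : H) (hs : s ∈ Set.Icc (0 : H) u) (ht : t ∈ Set.Icc (0 : H) u)
    (hst : s + t < u) :
    (∀ a ∈ Mt s, ∀ b ∈ Mt t, a + b ≤ v) ∧
    Mt s + Mt t = Mt (s + t) ∧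
    ∀ z ∈ Mt (s + t), ∃ a ∈ Mt s, ∃ b ∈ Mt t, z = a + b := by
  have hle : ∀ a ∈ Mt s, ∀ b ∈ Mt t, a + b ≤ v :=
    fun a ha b hb => hdec.add_le hs ht hst ha hb
  have hsplit : ∀ z ∈ Mt (s + t), ∃ a ∈ Mt s, ∃ b ∈ Mt t, z = a + b :=
    fun z hz => hdec.exists_eq_add hu hsuK.1 hs ht hst hz
  refine ⟨hle, Set.Subset.antisymm ?_ ?_, hsplit⟩
  · rintro _ ⟨a, ha, b, hb, rfl⟩
    have h := hdec.oplus_mem s hs t ht a ha b hb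
    rwa [inf_eq_left.mpr (hle a ha b hb), min_eq_left hst.le] at h
  · intro z hz
    obtain ⟨a, ha, b, hb, rfl⟩ := hsplit z hz
    exact Set.add_mem_add ha hb
end Decomposition
end

section
/- Let M = Γ(K,v) be an (H,u)-perfect pseudo MV-algebra with (H,u)-decomposition (M_t : t ∈ [0,u]_H). If a ∈ M_s, b ∈ M_t and s + t > u, then the partial sum a + b is not defined in M, i.e. a + b ≰ v in K. -/
open Pointwise

section Decomposition

variable {H : Type*} [AddGroup H] [LinearOrder H]
  [CovariantClass H H (· + ·) (· ≤ ·)]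
  [CovariantClass H H (Function.swap (· + ·)) (· ≤ ·)]
variable {K : Type*} [AddGroup K] [Lattice K]
  [CovariantClass K K (· + ·) (· ≤ ·)]
  [CovariantClass K K (Function.swap (· + ·)) (· ≤ ·)]

/-- In an `(H,u)`-perfect pseudo MV-algebra `M = Γ(K,v)` with
`(H,u)`-decomposition `(Mt t)`: if `a ∈ Mt s`, `b ∈ Mt t` and `s + t > u`, then the
partial sum `a + b` is not defined in `M`, i.e. `¬ (a + b ≤ v)`. -/
theorem statement_2 (u : H) (v : K) (hu : 0 < u)
    (hsuH : IsStrongOrderUnit u) (hsuK : IsStrongOrderUnit v)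
    (Mt : H → Set K) (hdec : IsHuDecomposition u v Mt)
    (s t : H) (hs : s ∈ Set.Icc (0 : H) u) (ht : t ∈ Set.Icc (0 : H) u)
    (a b : K) (ha : a ∈ Mt s) (hb : b ∈ Mt t) (hst : u < s + t) :
    ¬ a + b ≤ v := by
  intro hab
  have hut : u - t ∈ Set.Icc (0 : H) u :=
    ⟨sub_nonneg.2 ht.2, sub_le_self u ht.1⟩
  have hvb : v - b ∈ Mt (u - t) := hdec.compl_image t ht ▸ Set.mem_image_of_mem _ hb
  have hlt : u - t < s := sub_lt_iff_lt_add.2 hst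
  have heq : v - b = a :=
    le_antisymm (hdec.le_of_lt _ hut _ hs hlt _ hvb _ ha) (le_sub_iff_add_le.2 hab)
  exact Set.disjoint_left.1 (hdec.pairwise_disjoint _ hut _ hs hlt.ne) hvb (heq ▸ ha)
end Decomposition
end

section
/- Let M = Γ(K,v) be an (H,u)-perfect pseudo MV-algebra with (H,u)-decomposition (M_t : t ∈ [0,u]_H). If a ∈ M_s and b ∈ M_t, then a ∨ b ∈ M_{max(s,t)} and a ∧ b ∈ M_{min(s,t)}. -/
open Pointwise

section Decomposition

variable {H : Type*} [AddGroup H] [LinearOrder H]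
  [CovariantClass H H (· + ·) (· ≤ ·)]
  [CovariantClass H H (Function.swap (· + ·)) (· ≤ ·)]
variable {K : Type*} [AddGroup K] [Lattice K]
  [CovariantClass K K (· + ·) (· ≤ ·)]
  [CovariantClass K K (Function.swap (· + ·)) (· ≤ ·)]

theorem IsHuDecomposition.sup_mem {u : H} {v : K} {Mt : H → Set K}
    (hdec : IsHuDecomposition u v Mt) {t : H} (ht : t ∈ Set.Icc (0 : H) u)
    {a b : K} (ha : a ∈ Mt t) (hb : b ∈ Mt t) : a ⊔ b ∈ Mt t := by
  have hu : (0 : H) ≤ u := ht.1.trans ht.2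
  have hb' : v - b ∈ Mt (u - t) := hdec.compl_image t ht ▸ Set.mem_image_of_mem _ hb
  have hut : u - t ∈ Set.Icc (0 : H) u := by
    refine ⟨sub_nonneg.2 ht.2, ?_⟩
    rw [sub_le_iff_le_add]
    exact le_add_of_nonneg_right ht.1
  have hd : (v - b + a) ⊓ v ∈ Mt u := by
    simpa using hdec.oplus_mem _ hut _ ht _ hb' _ ha
  have hc : -((v - b + a) ⊓ v) + v ∈ Mt 0 := by
    have h := hdec.sim_image u ⟨hu, le_rfl⟩
    rw [neg_add_cancel] at h
    exact h ▸ Set.mem_image_of_mem _ hd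
  have hsup : a + (-((v - b + a) ⊓ v) + v) = a ⊔ b := by
    rw [neg_inf, sup_add, add_sup, sup_comm a b]
    congr 1
    · simp [sub_eq_add_neg, add_assoc]
    · simp
  have h := hdec.oplus_mem _ ht _ ⟨le_rfl, hu⟩ _ ha _ hc
  rw [hsup, add_zero, min_eq_left ht.2, inf_eq_left.2] at h
  · exact h
  · exact sup_le (hdec.subset_carrier t ht ha).2 (hdec.subset_carrier t ht hb).2

theorem IsHuDecomposition.inf_mem {u : H} {v : K} {Mt : H → Set K}
    (hdec : IsHuDecomposition u v Mt) {t : H} (ht : t ∈ Set.Icc (0 : H) u)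
    {a b : K} (ha : a ∈ Mt t) (hb : b ∈ Mt t) : a ⊓ b ∈ Mt t := by
  have ha' : -a + v ∈ Mt (-t + u) := hdec.sim_image t ht ▸ Set.mem_image_of_mem _ ha
  have hb' : -b + v ∈ Mt (-t + u) := hdec.sim_image t ht ▸ Set.mem_image_of_mem _ hb
  have hut : -t + u ∈ Set.Icc (0 : H) u := by
    refine ⟨le_neg_add_iff_add_le.2 (by simpa using ht.2), ?_⟩
    rw [neg_add_le_iff_le_add]
    exact le_add_of_nonneg_left ht.1
  have h := Set.mem_image_of_mem (fun x => v - x) (hdec.sup_mem hut ha' hb')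
  rw [hdec.compl_image _ hut] at h
  have hinf : v - ((-a + v) ⊔ (-b + v)) = a ⊓ b := by
    rw [← sup_add, ← neg_inf]
    simp [sub_eq_add_neg]
  simpa [hinf, sub_eq_add_neg] using h

/-- In an `(H,u)`-perfect pseudo MV-algebra `M = Γ(K,v)` with
`(H,u)`-decomposition `(Mt t)`: if `a ∈ Mt s` and `b ∈ Mt t`, then
`a ⊔ b ∈ Mt (max s t)` and `a ⊓ b ∈ Mt (min s t)`. -/
theorem statement_3 (u : H) (v : K) (hu : 0 < u)
    (hsuH : IsStrongOrderUnit u) (hsuK : IsStrongOrderUnit v)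
    (Mt : H → Set K) (hdec : IsHuDecomposition u v Mt)
    (s t : H) (hs : s ∈ Set.Icc (0 : H) u) (ht : t ∈ Set.Icc (0 : H) u)
    (a b : K) (ha : a ∈ Mt s) (hb : b ∈ Mt t) :
    a ⊔ b ∈ Mt (max s t) ∧ a ⊓ b ∈ Mt (min s t) := by
  rcases lt_trichotomy s t with h | rfl | h
  · have hab := hdec.le_of_lt s hs t ht h a ha b hb
    rw [sup_eq_right.2 hab, inf_eq_left.2 hab, max_eq_right h.le, min_eq_left h.le]
    exact ⟨hb, ha⟩
  · rw [max_self, min_self]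
    exact ⟨hdec.sup_mem hs ha hb, hdec.inf_mem hs ha hb⟩
  · have hba := hdec.le_of_lt t ht s hs h b hb a ha
    rw [sup_eq_left.2 hba, inf_eq_right.2 hba, max_eq_left h.le, min_eq_right h.le]
    exact ⟨ha, hb⟩
end Decomposition
end

section
/- Let M = Γ(K,v) be an (H,u)-perfect pseudo MV-algebra with (H,u)-decomposition (M_t : t ∈ [0,u]_H). Then M admits a state s such that M_0 ⊆ Ker(s). -/
open Pointwise

section Decomposition

variable {H : Type*} [AddGroup H] [LinearOrder H]
  [CovariantClass H H (· + ·) (· ≤ ·)]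
  [CovariantClass H H (Function.swap (· + ·)) (· ≤ ·)]
variable {K : Type*} [AddGroup K] [Lattice K]
  [CovariantClass K K (· + ·) (· ≤ ·)]
  [CovariantClass K K (Function.swap (· + ·)) (· ≤ ·)]

section StateOnLinearGroup

variable {G : Type*} [AddGroup G] [LinearOrder G]

/-- The least natural number `k` with `t ≤ k • u`. -/
noncomputable def unitCeil (u t : G) : ℕ := sInf {k : ℕ | t ≤ k • u}

theorem unitCeil_le {u t : G} {k : ℕ} (h : t ≤ k • u) : unitCeil u t ≤ k :=
  Nat.sInf_le h

theorem IsStrongOrderUnit.le_unitCeil_nsmul {u : G} (hu : IsStrongOrderUnit u) (t : G) :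
    t ≤ unitCeil u t • u :=
  Nat.sInf_mem (s := {k : ℕ | t ≤ k • u}) ((hu.2 t).imp fun _ h => h.2)

theorem IsStrongOrderUnit.unitCeil_mono {u : G} (hu : IsStrongOrderUnit u) :
    Monotone (unitCeil u) := fun _ t h => unitCeil_le (h.trans (hu.le_unitCeil_nsmul t))

theorem nsmul_lt_of_lt_unitCeil {u t : G} {k : ℕ} (h : k < unitCeil u t) : k • u < t :=
  lt_of_not_ge fun h' => (unitCeil_le h').not_gt h

variable [CovariantClass G G (· + ·) (· ≤ ·)]

theorem IsStrongOrderUnit.unitCeil_nsmul_self {u : G} (hu : IsStrongOrderUnit u) (hpos : 0 < u)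
    (n : ℕ) : unitCeil u (n • u) = n :=
  le_antisymm (unitCeil_le le_rfl) <| le_of_not_gt fun h =>
    (hu.le_unitCeil_nsmul (n • u)).not_gt (nsmul_left_strictMono hpos h)

variable [CovariantClass G G (Function.swap (· + ·)) (· ≤ ·)]

theorem add_nsmul_le_nsmul_add {s t : G} (h : s + t ≤ t + s) (n : ℕ) :
    s + n • t ≤ n • t + s := by
  induction n with
  | zero => simp
  | succ n ih =>
    calc s + (n + 1) • t = (s + n • t) + t := by rw [succ_nsmul, add_assoc]
      _ ≤ (n • t + s) + t := by gcongr
      _ = n • t + (s + t) := add_assoc _ _ _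
      _ ≤ n • t + (t + s) := by gcongr
      _ = (n + 1) • t + s := by rw [succ_nsmul, add_assoc]

theorem nsmul_add_nsmul_le_nsmul_add {s t : G} (h : s + t ≤ t + s) (n : ℕ) :
    n • s + n • t ≤ n • (s + t) := by
  induction n with
  | zero => simp
  | succ n ih =>
    calc (n + 1) • s + (n + 1) • t = n • s + (s + n • t) + t := by
          simp only [succ_nsmul, add_assoc]
      _ ≤ n • s + (n • t + s) + t := by exact add_le_add_left (add_le_add_right (add_nsmul_le_nsmul_add h n) _) _
      _ = (n • s + n • t) + (s + t) := by simp only [add_assoc]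
      _ ≤ n • (s + t) + (s + t) := by gcongr
      _ = (n + 1) • (s + t) := (succ_nsmul _ _).symm

theorem nsmul_add_le_nsmul_add_nsmul {s t : G} (h : s + t ≤ t + s) (n : ℕ) :
    n • (t + s) ≤ n • t + n • s := by
  induction n with
  | zero => simp
  | succ n ih =>
    calc (n + 1) • (t + s) = (t + s) + n • (t + s) := succ_nsmul' _ _
      _ ≤ (t + s) + (n • t + n • s) := by gcongr
      _ = t + (s + n • t) + n • s := by simp only [add_assoc]
      _ ≤ t + (n • t + s) + n • s := by exact add_le_add_left (add_le_add_right (add_nsmul_le_nsmul_add h n) _) _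
      _ = (n + 1) • t + (n + 1) • s := by simp only [succ_nsmul', add_assoc]

theorem IsStrongOrderUnit.unitCeil_add_le {u : G} (hu : IsStrongOrderUnit u) (s t : G) :
    unitCeil u (s + t) ≤ unitCeil u s + unitCeil u t := by
  apply unitCeil_le
  rw [add_nsmul]
  exact add_le_add (hu.le_unitCeil_nsmul s) (hu.le_unitCeil_nsmul t)

theorem IsStrongOrderUnit.unitCeil_add_unitCeil_le {u : G} (hu : IsStrongOrderUnit u) {s t : G}
    (hs : 0 ≤ s) (ht : 0 ≤ t) : unitCeil u s + unitCeil u t ≤ unitCeil u (s + t) + 2 := by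
  rcases Nat.eq_zero_or_pos (unitCeil u s) with h | h
  · have := hu.unitCeil_mono (le_add_of_nonneg_left hs : t ≤ s + t)
    omega
  rcases Nat.eq_zero_or_pos (unitCeil u t) with h' | h'
  · have := hu.unitCeil_mono (le_add_of_nonneg_right ht : s ≤ s + t)
    omega
  by_contra! hlt
  have h₁ : (unitCeil u s - 1) • u < s := nsmul_lt_of_lt_unitCeil (by omega)
  have h₂ : (unitCeil u t - 1) • u < t := nsmul_lt_of_lt_unitCeil (by omega)
  have h₃ := add_lt_add h₁ h₂
  rw [← add_nsmul] at h₃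
  exact (h₃.trans_le (hu.le_unitCeil_nsmul (s + t))).not_ge
    (nsmul_le_nsmul_left hu.1 (by omega))

theorem IsStrongOrderUnit.unitCeil_nsmul_add_bounds {u : G} (hu : IsStrongOrderUnit u) {s t : G}
    (hs : 0 ≤ s) (ht : 0 ≤ t) (n : ℕ) :
    unitCeil u (n • (s + t)) ≤ unitCeil u (n • s) + unitCeil u (n • t) ∧
      unitCeil u (n • s) + unitCeil u (n • t) ≤ unitCeil u (n • (s + t)) + 2 := by
  have hns := nsmul_nonneg hs n
  have hnt := nsmul_nonneg ht n
  rcases le_total (s + t) (t + s) with h | h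
  · have h₁ := hu.unitCeil_mono (nsmul_add_nsmul_le_nsmul_add h n)
    have h₂ := hu.unitCeil_mono
      ((nsmul_le_nsmul_right h n).trans (nsmul_add_le_nsmul_add_nsmul h n))
    have h₃ := hu.unitCeil_add_le (n • t) (n • s)
    have h₄ := hu.unitCeil_add_unitCeil_le hns hnt
    omega
  · have h₁ := hu.unitCeil_mono
      ((nsmul_add_nsmul_le_nsmul_add h n).trans (nsmul_le_nsmul_right h n))
    have h₂ := hu.unitCeil_mono (nsmul_add_le_nsmul_add_nsmul h n)
    have h₃ := hu.unitCeil_add_le (n • s) (n • t)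
    have h₄ := hu.unitCeil_add_unitCeil_le hnt hns
    omega

theorem IsStrongOrderUnit.exists_tendsto_unitCeil_div {u : G} (hu : IsStrongOrderUnit u)
    (t : G) : ∃ r : ℝ, Filter.Tendsto (fun n : ℕ => (unitCeil u (n • t) : ℝ) / n)
      Filter.atTop (nhds r) := by
  have hsub : Subadditive fun n : ℕ => (unitCeil u (n • t) : ℝ) := fun m n => by
    simp only [add_nsmul]
    exact_mod_cast hu.unitCeil_add_le (m • t) (n • t)
  refine ⟨_, hsub.tendsto_lim ⟨0, ?_⟩⟩
  rintro _ ⟨n, rfl⟩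
  positivity

/-- A linearly ordered group with a strong unit carries a state: a nonnegative additive
functional on the positive cone which is normalized at the unit. -/
theorem IsStrongOrderUnit.exists_state {u : G} (hu : IsStrongOrderUnit u) (hpos : 0 < u) :
    ∃ f : G → ℝ, f u = 1 ∧ (∀ t, 0 ≤ f t) ∧
      ∀ s t, 0 ≤ s → 0 ≤ t → f (s + t) = f s + f t := by
  choose f hf using hu.exists_tendsto_unitCeil_div
  refine ⟨f, ?_, ?_, ?_⟩
  · refine tendsto_nhds_unique (hf u) (tendsto_const_nhds.congr' ?_)
    filter_upwards [Filter.eventually_gt_atTop 0] with n hn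
    rw [hu.unitCeil_nsmul_self hpos, div_self (by positivity)]
  · exact fun t => ge_of_tendsto' (hf t) fun n => by positivity
  · intro s t hs ht
    refine le_antisymm (le_of_tendsto_of_tendsto' (hf (s + t)) ((hf s).add (hf t)) ?_) ?_
    · intro n
      rw [← add_div]
      gcongr
      exact_mod_cast (hu.unitCeil_nsmul_add_bounds hs ht n).1
    · have hlim := (hf (s + t)).add (tendsto_const_div_atTop_nhds_zero_nat (2 : ℝ))
      rw [add_zero] at hlim
      refine le_of_tendsto_of_tendsto' ((hf s).add (hf t)) hlim fun n => ?_
      rw [← add_div, ← add_div]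
      refine div_le_div_of_nonneg_right ?_ n.cast_nonneg
      exact_mod_cast (hu.unitCeil_nsmul_add_bounds hs ht n).2

end StateOnLinearGroup

/-- An `(H,u)`-perfect pseudo MV-algebra `M = Γ(K,v)` with
`(H,u)`-decomposition `(Mt t)` admits a state `st` (a `[0,1]`-valued map with
`st v = 1` that is additive on defined partial sums) such that `Mt 0 ⊆ Ker st`. -/
theorem statement_4 (u : H) (v : K) (hu : 0 < u)
    (hsuH : IsStrongOrderUnit u) (hsuK : IsStrongOrderUnit v)
    (Mt : H → Set K) (hdec : IsHuDecomposition u v Mt) :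
    ∃ st : K → ℝ,
      (∀ x ∈ Set.Icc (0 : K) v, st x ∈ Set.Icc (0 : ℝ) 1) ∧
      st v = 1 ∧
      (∀ x ∈ Set.Icc (0 : K) v, ∀ y ∈ Set.Icc (0 : K) v, x + y ≤ v →
        st (x + y) = st x + st y) ∧
      ∀ x ∈ Mt 0, st x = 0 := by
  obtain ⟨f, hfu, hf0, hfadd⟩ := hsuH.exists_state hu
  have hfzero : f 0 = 0 := by simpa using hfadd 0 0 le_rfl le_rfl
  have hmem0 : (0 : H) ∈ Set.Icc 0 u := ⟨le_rfl, hu.le⟩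
  have huniq : ∀ x, ∀ s ∈ Set.Icc (0 : H) u, ∀ t ∈ Set.Icc (0 : H) u,
      x ∈ Mt s → x ∈ Mt t → s = t := fun x s hs t ht hxs hxt => by
    by_contra hne
    exact Set.disjoint_left.1 (hdec.pairwise_disjoint s hs t ht hne) hxs hxt
  have hdeg : ∀ x : K, ∃ t, x ∈ Set.Icc (0 : K) v → t ∈ Set.Icc (0 : H) u ∧ x ∈ Mt t := fun x => by
    by_cases hx : x ∈ Set.Icc (0 : K) v
    · obtain ⟨t, ht⟩ := hdec.cover x hx
      exact ⟨t, fun _ => ht⟩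
    · exact ⟨0, fun h => absurd h hx⟩
  choose d hd using hdeg
  have hd_eq : ∀ t ∈ Set.Icc (0 : H) u, ∀ x ∈ Mt t, d x = t := fun t ht x hx =>
    have hx' := hd x (hdec.subset_carrier t ht hx)
    huniq x _ hx'.1 t ht hx'.2 hx
  have hzero : (0 : K) ∈ Mt 0 := by
    obtain ⟨hd0, hmem⟩ := hd 0 ⟨le_rfl, hsuK.1⟩
    rcases hd0.1.eq_or_lt with h | h
    · rwa [← h] at hmem
    · obtain ⟨x, hx⟩ := hdec.nonempty 0 hmem0
      rwa [← le_antisymm (hdec.le_of_lt 0 hmem0 _ hd0 h x hx 0 hmem)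
        (hdec.subset_carrier 0 hmem0 hx).1]
  have hv : v ∈ Mt u := by
    have h := hdec.compl_image 0 hmem0
    rw [sub_zero] at h
    rw [← h]
    exact ⟨0, hzero, sub_zero v⟩
  refine ⟨fun x => f (d x), fun x hx => ⟨hf0 _, ?_⟩, ?_, fun x hx y hy hxy => ?_, fun x hx => ?_⟩
  · have hdx := (hd x hx).1
    have h := hfadd (d x) (-d x + u) hdx.1 (by simpa using hdx.2)
    rw [add_neg_cancel_left, hfu] at h
    linarith [hf0 (-d x + u)]
  · simp only [hd_eq u ⟨hu.le, le_rfl⟩ v hv, hfu]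
  · obtain ⟨hdx, hxm⟩ := hd x hx
    obtain ⟨hdy, hym⟩ := hd y hy
    have hc : u - d y ∈ Set.Icc (0 : H) u :=
      ⟨sub_nonneg.2 hdy.2, sub_le_self _ hdy.1⟩
    have hvy : v - y ∈ Mt (u - d y) := by
      rw [← hdec.compl_image _ hdy]
      exact ⟨y, hym, rfl⟩
    have hle : d x + d y ≤ u := by
      rw [← le_sub_iff_add_le]
      by_contra! hlt
      have heq : x = v - y := le_antisymm (le_sub_iff_add_le.2 hxy)
        (hdec.le_of_lt _ hc _ hdx hlt _ hvy _ hxm)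
      rw [← heq] at hvy
      exact hlt.ne (huniq x _ hc _ hdx hvy hxm)
    have hsum := hdec.oplus_mem _ hdx _ hdy x hxm y hym
    rw [inf_eq_left.2 hxy, min_eq_left hle] at hsum
    simp only [hd_eq _ ⟨add_nonneg hdx.1 hdy.1, hle⟩ _ hsum]
    exact hfadd _ _ hdx.1 hdy.1
  · simp only [hd_eq 0 hmem0 x hx, hfzero]

end Decomposition
end

section
/- Let M = Γ(K,v) be an (H,u)-perfect pseudo MV-algebra with (H,u)-decomposition (M_t : t ∈ [0,u]_H). Then M_0 is a normal ideal of M, M_0 + M_0 is defined in M with M_0 + M_0 = M_0, and M_0 ⊆ Infinit(M). -/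
open Pointwise

section Decomposition

variable {H : Type*} [AddGroup H] [LinearOrder H]
  [CovariantClass H H (· + ·) (· ≤ ·)]
  [CovariantClass H H (Function.swap (· + ·)) (· ≤ ·)]
variable {K : Type*} [AddGroup K] [Lattice K]
  [CovariantClass K K (· + ·) (· ≤ ·)]
  [CovariantClass K K (Function.swap (· + ·)) (· ≤ ·)]

/-- An ideal of the pseudo MV-algebra `Γ(K,v)`: a nonempty subset `I` of `[0,v]`
closed downwards (within `[0,v]`) and closed under `⊕` (`x ⊕ y = (x + y) ⊓ v`). -/
def IsIdeal (v : K) (I : Set K) : Prop :=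
  I.Nonempty ∧ I ⊆ Set.Icc (0 : K) v ∧
  (∀ a ∈ Set.Icc (0 : K) v, ∀ b ∈ I, a ≤ b → a ∈ I) ∧
  ∀ a ∈ I, ∀ b ∈ I, (a + b) ⊓ v ∈ I

/-- A normal ideal: `{x} ⊕ I = I ⊕ {x}` for every `x ∈ Γ(K,v)`. -/
def IsNormalIdeal (v : K) (I : Set K) : Prop :=
  IsIdeal v I ∧
  ∀ x ∈ Set.Icc (0 : K) v, (fun y => (x + y) ⊓ v) '' I = (fun y => (y + x) ⊓ v) '' I

set_option linter.unusedSectionVars false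

namespace IsHuDecomposition

variable {u : H} {v : K} {Mt : H → Set K}

theorem index_unique_s5 (hdec : IsHuDecomposition u v Mt) {s t : H} (hs : s ∈ Set.Icc (0 : H) u)
    (ht : t ∈ Set.Icc (0 : H) u) {x : K} (hxs : x ∈ Mt s) (hxt : x ∈ Mt t) : s = t := by
  by_contra hne
  exact Set.disjoint_left.mp (hdec.pairwise_disjoint s hs t ht hne) hxs hxt

theorem mem_zero_of_le (hdec : IsHuDecomposition u v Mt) (hu : 0 < u) {a b : K}
    (ha : a ∈ Set.Icc (0 : K) v) (hb : b ∈ Mt 0) (hab : a ≤ b) : a ∈ Mt 0 := by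
  obtain ⟨t, ht, hat⟩ := hdec.cover a ha
  rcases ht.1.eq_or_lt with h | h
  · rwa [h]
  · rwa [hab.antisymm (hdec.le_of_lt 0 ⟨le_rfl, hu.le⟩ t ht h b hb a hat)]

theorem zero_mem_s5 (hdec : IsHuDecomposition u v Mt) (hu : 0 < u) : (0 : K) ∈ Mt 0 := by
  have h0 : (0 : H) ∈ Set.Icc (0 : H) u := ⟨le_rfl, hu.le⟩
  obtain ⟨a, ha⟩ := hdec.nonempty 0 h0
  have hav := hdec.subset_carrier 0 h0 ha
  exact hdec.mem_zero_of_le hu ⟨le_rfl, hav.1.trans hav.2⟩ ha hav.1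

theorem add_le_s5 (hdec : IsHuDecomposition u v Mt) (hu : 0 < u) {a b : K}
    (ha : a ∈ Mt 0) (hb : b ∈ Mt 0) : a + b ≤ v := by
  have h0 : (0 : H) ∈ Set.Icc (0 : H) u := ⟨le_rfl, hu.le⟩
  have hvb : v - b ∈ Mt u := by
    have h : v - b ∈ (fun x => v - x) '' Mt 0 := ⟨b, hb, rfl⟩
    rwa [hdec.compl_image 0 h0, sub_zero] at h
  exact le_sub_iff_add_le.mp (hdec.le_of_lt 0 h0 u ⟨hu.le, le_rfl⟩ hu a ha _ hvb)

theorem oplus_mem_zero (hdec : IsHuDecomposition u v Mt) (hu : 0 < u) {a b : K}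
    (ha : a ∈ Mt 0) (hb : b ∈ Mt 0) : (a + b) ⊓ v ∈ Mt 0 := by
  have h0 : (0 : H) ∈ Set.Icc (0 : H) u := ⟨le_rfl, hu.le⟩
  have h := hdec.oplus_mem 0 h0 0 h0 a ha b hb
  rwa [add_zero, min_eq_left hu.le] at h

theorem add_mem_zero (hdec : IsHuDecomposition u v Mt) (hu : 0 < u) {a b : K}
    (ha : a ∈ Mt 0) (hb : b ∈ Mt 0) : a + b ∈ Mt 0 := by
  have h := hdec.oplus_mem_zero hu ha hb
  rwa [inf_eq_left.mpr (hdec.add_le_s5 hu ha hb)] at h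

theorem nsmul_mem_zero (hdec : IsHuDecomposition u v Mt) (hu : 0 < u) {x : K}
    (hx : x ∈ Mt 0) (n : ℕ) : n • x ∈ Mt 0 := by
  induction n with
  | zero => rw [zero_nsmul]; exact hdec.zero_mem_s5 hu
  | succ n ih => rw [succ_nsmul]; exact hdec.add_mem_zero hu ih hx

theorem isIdeal_zero (hdec : IsHuDecomposition u v Mt) (hu : 0 < u) : IsIdeal v (Mt 0) :=
  ⟨⟨0, hdec.zero_mem_s5 hu⟩, hdec.subset_carrier 0 ⟨le_rfl, hu.le⟩,
    fun _ ha _ hb hab => hdec.mem_zero_of_le hu ha hb hab,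
    fun _ ha _ hb => hdec.oplus_mem_zero hu ha hb⟩

/-- If `x` and `z + x` lie in the same component, then `z` lies in the zero component. -/
theorem mem_zero_of_add_mem_left (hdec : IsHuDecomposition u v Mt) (hu : 0 < u) {s : H}
    (hs : s ∈ Set.Icc (0 : H) u) {x z : K} (hx : x ∈ Mt s) (hz : 0 ≤ z)
    (hzx : z + x ∈ Mt s) : z ∈ Mt 0 := by
  have hx' := hdec.subset_carrier s hs hx
  have hzx' := hdec.subset_carrier s hs hzx
  have hzv : z ∈ Set.Icc (0 : K) v := ⟨hz, (le_add_of_nonneg_right hx'.1).trans hzx'.2⟩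
  obtain ⟨t, ht, hzt⟩ := hdec.cover z hzv
  have h := hdec.oplus_mem t ht s hs z hzt x hx
  rw [inf_eq_left.mpr hzx'.2] at h
  have heq := hdec.index_unique_s5 hs
    ⟨le_min (add_nonneg ht.1 hs.1) hu.le, min_le_right _ _⟩ hzx h
  rcases hs.2.eq_or_lt with rfl | hsu
  · have hc : v - x ∈ (fun x => v - x) '' Mt s := ⟨x, hx, rfl⟩
    rw [hdec.compl_image s hs, sub_self] at hc
    exact hdec.mem_zero_of_le hu hzv hc (le_sub_iff_add_le.mpr hzx'.2)
  · rcases min_choice (t + s) u with hm | hm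
    · rw [hm, eq_comm, add_eq_right] at heq
      rwa [heq] at hzt
    · exact absurd (heq.trans hm) hsu.ne

/-- If `x` and `x + z` lie in the same component, then `z` lies in the zero component. -/
theorem mem_zero_of_add_mem_right (hdec : IsHuDecomposition u v Mt) (hu : 0 < u) {s : H}
    (hs : s ∈ Set.Icc (0 : H) u) {x z : K} (hx : x ∈ Mt s) (hz : 0 ≤ z)
    (hxz : x + z ∈ Mt s) : z ∈ Mt 0 := by
  have hx' := hdec.subset_carrier s hs hx
  have hxz' := hdec.subset_carrier s hs hxz
  have hzv : z ∈ Set.Icc (0 : K) v := ⟨hz, (le_add_of_nonneg_left hx'.1).trans hxz'.2⟩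
  obtain ⟨t, ht, hzt⟩ := hdec.cover z hzv
  have h := hdec.oplus_mem s hs t ht x hx z hzt
  rw [inf_eq_left.mpr hxz'.2] at h
  have heq := hdec.index_unique_s5 hs
    ⟨le_min (add_nonneg hs.1 ht.1) hu.le, min_le_right _ _⟩ hxz h
  rcases hs.2.eq_or_lt with rfl | hsu
  · have hc : -x + v ∈ (fun x => -x + v) '' Mt s := ⟨x, hx, rfl⟩
    rw [hdec.sim_image s hs, neg_add_cancel] at hc
    exact hdec.mem_zero_of_le hu hzv hc (le_neg_add_iff_add_le.mpr hxz'.2)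
  · rcases min_choice (s + t) u with hm | hm
    · rw [hm, eq_comm, add_eq_left] at heq
      rwa [heq] at hzt
    · exact absurd (heq.trans hm) hsu.ne

theorem isNormalIdeal_zero (hdec : IsHuDecomposition u v Mt) (hu : 0 < u) :
    IsNormalIdeal v (Mt 0) := by
  have h0 : (0 : H) ∈ Set.Icc (0 : H) u := ⟨le_rfl, hu.le⟩
  refine ⟨hdec.isIdeal_zero hu, fun x hx => ?_⟩
  obtain ⟨s, hs, hxs⟩ := hdec.cover x hx
  apply Set.Subset.antisymm
  · rintro _ ⟨y, hy, rfl⟩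
    have hy0 := (hdec.subset_carrier 0 h0 hy).1
    have hw := hdec.oplus_mem s hs 0 h0 x hxs y hy
    rw [add_zero, min_eq_left hs.2] at hw
    have hxw : x ≤ (x + y) ⊓ v := le_inf (le_add_of_nonneg_right hy0) hx.2
    refine ⟨(x + y) ⊓ v - x, hdec.mem_zero_of_add_mem_left hu hs hxs (sub_nonneg.mpr hxw) ?_, ?_⟩
    · rwa [sub_add_cancel]
    · simp
  · rintro _ ⟨y, hy, rfl⟩
    have hy0 := (hdec.subset_carrier 0 h0 hy).1
    have hw := hdec.oplus_mem 0 h0 s hs y hy x hxs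
    rw [zero_add, min_eq_left hs.2] at hw
    have hxw : x ≤ (y + x) ⊓ v := le_inf (le_add_of_nonneg_left hy0) hx.2
    refine ⟨-x + (y + x) ⊓ v, hdec.mem_zero_of_add_mem_right hu hs hxs
      (le_neg_add_iff_add_le.mpr (by rwa [add_zero])) ?_, ?_⟩
    · rwa [add_neg_cancel_left]
    · simp

end IsHuDecomposition

/-- In an `(H,u)`-perfect pseudo MV-algebra `M = Γ(K,v)` with
`(H,u)`-decomposition `(Mt t)`: `Mt 0` is a normal ideal of `M`, `Mt 0 + Mt 0` is
defined in `M` with `Mt 0 + Mt 0 = Mt 0` (pointwise group addition), and every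
element of `Mt 0` is infinitesimal (`n • x ≤ v` for all `n ≥ 1`). -/
theorem statement_5 (u : H) (v : K) (hu : 0 < u)
    (hsuH : IsStrongOrderUnit u) (hsuK : IsStrongOrderUnit v)
    (Mt : H → Set K) (hdec : IsHuDecomposition u v Mt) :
    IsNormalIdeal v (Mt 0) ∧
    (∀ a ∈ Mt 0, ∀ b ∈ Mt 0, a + b ≤ v) ∧
    Mt 0 + Mt 0 = Mt 0 ∧
    ∀ x ∈ Mt 0, ∀ n : ℕ, 1 ≤ n → n • x ≤ v := by
  have h0 : (0 : H) ∈ Set.Icc (0 : H) u := ⟨le_rfl, hu.le⟩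
  refine ⟨hdec.isNormalIdeal_zero hu, fun a ha b hb => hdec.add_le_s5 hu ha hb, ?_,
    fun x hx n _ => (hdec.subset_carrier 0 h0 (hdec.nsmul_mem_zero hu hx n)).2⟩
  apply Set.Subset.antisymm
  · rintro _ ⟨a, ha, b, hb, rfl⟩
    exact hdec.add_mem_zero hu ha hb
  · exact fun a ha => ⟨a, ha, 0, hdec.zero_mem_s5 hu, add_zero a⟩
end Decomposition
end

section
/- Let H be a linearly ordered group with strong unit u > 0 and G an ℓ-group, and let M = Γ(H ×lex G, (u,0)). Define M_0 = {(0,g) : g ∈ G⁺}, M_u = {(u,−g) : g ∈ G⁺}, and M_t = {(t,g) : g ∈ G} for t ∈ [0,u]_H with 0 < t < u. Then (M_t : t ∈ [0,u]_H) is an (H,u)-decomposition of M, so M is (H,u)-perfect; moreover, with c_t = (t,0) for t ∈ [0,u]_H, M is strongly (H,u)-perfect. -/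
section LexDefs

variable {H G : Type*}

/-- The lexicographic order on the product `H × G`:
`(h,g) ≤ (h',g')` iff `h < h'` or (`h = h'` and `g ≤ g'`). -/
def lexLe [LT H] [LE G] (p q : H × G) : Prop :=
  p.1 < q.1 ∨ (p.1 = q.1 ∧ p.2 ≤ q.2)

/-- The meet in the lexicographic product of a linear order with a lattice. -/
def lexInf [LinearOrder H] [Lattice G] (p q : H × G) : H × G :=
  if p.1 < q.1 then p else if q.1 < p.1 then q else (p.1, p.2 ⊓ q.2)

/-- The join in the lexicographic product of a linear order with a lattice. -/
def lexSup [LinearOrder H] [Lattice G] (p q : H × G) : H × G :=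
  if p.1 < q.1 then q else if q.1 < p.1 then p else (p.1, p.2 ⊔ q.2)

end LexDefs

section LexGroup

variable {H : Type*} [AddGroup H] [LinearOrder H]
  [CovariantClass H H (· + ·) (· ≤ ·)]
  [CovariantClass H H (Function.swap (· + ·)) (· ≤ ·)]
variable {G : Type*} [AddGroup G] [Lattice G]
  [CovariantClass G G (· + ·) (· ≤ ·)]
  [CovariantClass G G (Function.swap (· + ·)) (· ≤ ·)]

/-- An `(H,u)`-decomposition of the pseudo MV-algebra `Γ(H ×lex G, w)` on the
lexicographic product: a family `(Mt t : t ∈ [0,u]_H)` of nonempty, pairwise disjoint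
subsets of the interval `[0, w]` (for the lexicographic order) covering it, such that
(a) `Mt s ≤ Mt t` for `s < t`; (b) `(Mt t)⁻ = Mt (u - t)` and `(Mt t)∼ = Mt (-t + u)`
(where `p⁻ = w - p`, `p∼ = -p + w`); (c) `x ⊕ y = (x + y) ⊓ w ∈ Mt (min (s+t) u)`. -/
structure IsHuDecompositionLex (u : H) (w : H × G) (Mt : H → Set (H × G)) : Prop where
  nonempty : ∀ t ∈ Set.Icc (0 : H) u, (Mt t).Nonempty
  subset_carrier : ∀ t ∈ Set.Icc (0 : H) u, ∀ p ∈ Mt t, lexLe 0 p ∧ lexLe p w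
  pairwise_disjoint : ∀ s ∈ Set.Icc (0 : H) u, ∀ t ∈ Set.Icc (0 : H) u,
    s ≠ t → Disjoint (Mt s) (Mt t)
  cover : ∀ p : H × G, lexLe 0 p → lexLe p w → ∃ t ∈ Set.Icc (0 : H) u, p ∈ Mt t
  le_of_lt : ∀ s ∈ Set.Icc (0 : H) u, ∀ t ∈ Set.Icc (0 : H) u, s < t →
    ∀ a ∈ Mt s, ∀ b ∈ Mt t, lexLe a b
  compl_image : ∀ t ∈ Set.Icc (0 : H) u, (fun p => w - p) '' Mt t = Mt (u - t)
  sim_image : ∀ t ∈ Set.Icc (0 : H) u, (fun p => -p + w) '' Mt t = Mt (-t + u)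
  oplus_mem : ∀ s ∈ Set.Icc (0 : H) u, ∀ t ∈ Set.Icc (0 : H) u,
    ∀ x ∈ Mt s, ∀ y ∈ Mt t, lexInf (x + y) w ∈ Mt (min (s + t) u)

/-- Let `H` be a linearly ordered group with strong unit `u > 0`, `G` an
ℓ-group, and `M = Γ(H ×lex G, (u,0))`. With `M_0 = {(0,g) : g ∈ G⁺}`,
`M_u = {(u,-g) : g ∈ G⁺}` and `M_t = {(t,g) : g ∈ G}` for `0 < t < u`, the family
`(Mt t : t ∈ [0,u]_H)` is an `(H,u)`-decomposition of `M`, so `M` is `(H,u)`-perfect;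
moreover, with `c t = (t,0)`, `M` is strongly `(H,u)`-perfect. -/
theorem statement_9 (u : H) (hu : 0 < u) (hsu : IsStrongOrderUnit u)
    (Mt : H → Set (H × G))
    (hMt : ∀ t : H, Mt t =
      if t = 0 then {p : H × G | p.1 = 0 ∧ 0 ≤ p.2}
      else if t = u then {p : H × G | p.1 = u ∧ p.2 ≤ 0}
      else {p : H × G | p.1 = t})
    (c : H → H × G) (hc : ∀ t : H, c t = ((t, 0) : H × G)) :
    IsHuDecompositionLex u ((u, 0) : H × G) Mt ∧
    (∀ t ∈ Set.Icc (0 : H) u, c t ∈ Mt t) ∧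
    (∀ s ∈ Set.Icc (0 : H) u, ∀ t ∈ Set.Icc (0 : H) u, s + t ≤ u →
      c (s + t) = c s + c t) ∧
    c u = ((u, 0) : H × G) ∧
    (∀ s ∈ Set.Icc (0 : H) u, ∀ t ∈ Set.Icc (0 : H) u, s + t ≤ u →
      ∀ x ∈ Mt s, ∀ y ∈ Mt t, (x + y) - c (s + t) = (x - c s) + (y - c t)) ∧
    (∀ t ∈ Set.Icc (0 : H) u, ∀ x ∈ Mt t, x - c t = -(c t) + x) := by
  have mem : ∀ (t : H) (p : H × G),
      p ∈ Mt t ↔ p.1 = t ∧ (t = 0 → 0 ≤ p.2) ∧ (t = u → p.2 ≤ 0) := by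
    intro t p
    rw [hMt]
    split_ifs with h0 h1
    · subst h0
      simp [hu.ne]
    · subst h1
      simp [hu.ne']
    · simp [h0, h1]
  have mem_c : ∀ t : H, c t ∈ Mt t := by
    intro t
    simp [mem, hc]
  refine ⟨⟨fun t _ => ⟨c t, mem_c t⟩, ?_, ?_, ?_, ?_, ?_, ?_, ?_⟩, fun t _ => mem_c t, ?_, hc u,
    ?_, ?_⟩
  · rintro t ⟨ht0, htu⟩ p hp
    obtain ⟨rfl, h0, h1⟩ := (mem t p).1 hp
    exact ⟨ht0.lt_or_eq.imp_right fun h => ⟨h, h0 h.symm⟩,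
      htu.lt_or_eq.imp_right fun h => ⟨h, h1 h⟩⟩
  · intro s _ t _ hst
    rw [Set.disjoint_left]
    intro p hs ht
    exact hst (((mem s p).1 hs).1.symm.trans ((mem t p).1 ht).1)
  · rintro p h0 h1
    refine ⟨p.1, ⟨h0.elim le_of_lt fun h => h.1.le, h1.elim le_of_lt fun h => h.1.le⟩,
      (mem _ _).2 ⟨rfl, fun h => ?_, fun h => ?_⟩⟩
    · exact h0.elim (fun h' => absurd h h'.ne') fun h' => h'.2
    · exact h1.elim (fun h' => absurd h h'.ne) fun h' => h'.2
  · intro s _ t _ hst a ha b hb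
    left
    rwa [((mem s a).1 ha).1, ((mem t b).1 hb).1]
  · intro t _
    ext q
    rw [mem]
    constructor
    · rintro ⟨p, hp, rfl⟩
      obtain ⟨rfl, h0, h1⟩ := (mem t p).1 hp
      refine ⟨rfl, fun h => ?_, fun h => ?_⟩
      · simpa using h1 (sub_eq_zero.1 h).symm
      · simpa using h0 (by simpa using h)
    · rintro ⟨hq, h0, h1⟩
      refine ⟨-q + (u, 0), (mem _ _).2 ⟨by simp [hq], fun h => ?_, fun h => ?_⟩, by simp⟩
      · simpa using h1 (by simp [h])
      · simpa using h0 (by simp [h])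
  · intro t _
    ext q
    rw [mem]
    constructor
    · rintro ⟨p, hp, rfl⟩
      obtain ⟨rfl, h0, h1⟩ := (mem t p).1 hp
      refine ⟨rfl, fun h => ?_, fun h => ?_⟩
      · simpa using h1 (neg_add_eq_zero.1 h)
      · simpa using h0 (by simpa using h)
    · rintro ⟨hq, h0, h1⟩
      refine ⟨(u, 0) - q, (mem _ _).2 ⟨by simp [hq, sub_eq_add_neg], fun h => ?_, fun h => ?_⟩,
        by simp⟩
      · simpa using h1 (by simp [h])
      · simpa using h0 (by simp [h])
  · rintro s ⟨hs0, _⟩ t ⟨ht0, _⟩ x hx y hy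
    obtain ⟨rfl, hx0, _⟩ := (mem s x).1 hx
    obtain ⟨rfl, hy0, _⟩ := (mem t y).1 hy
    rw [mem]
    rcases lt_trichotomy (x.1 + y.1) u with h | h | h
    · simp only [lexInf, Prod.fst_add, h, if_true, min_eq_left h.le]
      refine ⟨trivial, fun h' => ?_, fun h' => absurd h' h.ne⟩
      obtain ⟨h₁, h₂⟩ := (add_eq_zero_iff_of_nonneg hs0 ht0).1 h'
      exact add_nonneg (hx0 h₁) (hy0 h₂)
    · simp [lexInf, h, hu.ne']
    · simp [lexInf, h, h.not_gt, h.le, hu.ne']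
  · intro s _ t _ _
    simp [hc]
  · intro s _ t _ _ x hx y hy
    ext <;> simp [hc, ((mem s x).1 hx).1, ((mem t y).1 hy).1]
  · intro t _ x hx
    ext <;> simp [hc, ((mem t x).1 hx).1]

end LexGroup
end

section
/- Let H be a linearly ordered group with strong unit u > 0 and let M = Γ(K,v) be a strongly (H,u)-perfect pseudo MV-algebra with (H,u)-decomposition (M_t : t ∈ [0,u]_H) and elements (c_t : t ∈ [0,u]_H). Then M' = {c_t : t ∈ [0,u]_H} is a subalgebra of M (it contains 0 and v and is closed under ⊕, ⁻ and ∼), and the map t ↦ c_t is an isomorphism of pseudo MV-algebras from Γ(H,u) onto M'. -/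
open Pointwise

section Decomposition

variable {H : Type*} [AddGroup H] [LinearOrder H]
  [CovariantClass H H (· + ·) (· ≤ ·)]
  [CovariantClass H H (Function.swap (· + ·)) (· ≤ ·)]
variable {K : Type*} [AddGroup K] [Lattice K]
  [CovariantClass K K (· + ·) (· ≤ ·)]
  [CovariantClass K K (Function.swap (· + ·)) (· ≤ ·)]

/-- A subalgebra of the pseudo MV-algebra `Γ(K,v)`: a subset of `[0,v]` containing
`0` and `v` and closed under `⊕` (`x ⊕ y = (x + y) ⊓ v`), `⁻` (`x⁻ = v - x`) and
`∼` (`x∼ = -x + v`). -/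
def IsSubalgebra (v : K) (S : Set K) : Prop :=
  S ⊆ Set.Icc (0 : K) v ∧ (0 : K) ∈ S ∧ v ∈ S ∧
  (∀ x ∈ S, ∀ y ∈ S, (x + y) ⊓ v ∈ S) ∧
  (∀ x ∈ S, v - x ∈ S) ∧ (∀ x ∈ S, -x + v ∈ S)

/-- Let `M = Γ(K,v)` be strongly `(H,u)`-perfect with decomposition
`(Mt t)` and elements `(c t)`. Then `M' = {c t : t ∈ [0,u]_H}` is a subalgebra of `M`,
and `t ↦ c t` is an isomorphism of pseudo MV-algebras from `Γ(H,u)` onto `M'`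
(injective, onto `M'`, sending `0 ↦ 0`, `u ↦ v`, `min (s+t) u ↦ (c s + c t) ⊓ v`,
`u - t ↦ v - c t` and `-t + u ↦ -(c t) + v`). -/
theorem statement_12 (u : H) (v : K) (hu : 0 < u)
    (hsuH : IsStrongOrderUnit u) (hsuK : IsStrongOrderUnit v)
    (Mt : H → Set K) (c : H → K)
    (hdec : IsHuDecomposition u v Mt)
    (hc_mem : ∀ t ∈ Set.Icc (0 : H) u, c t ∈ Mt t)
    (hc_add : ∀ s ∈ Set.Icc (0 : H) u, ∀ t ∈ Set.Icc (0 : H) u, s + t ≤ u →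
      c (s + t) = c s + c t)
    (hc_u : c u = v)
    (hc_lex : ∀ s ∈ Set.Icc (0 : H) u, ∀ t ∈ Set.Icc (0 : H) u, s + t ≤ u →
      ∀ x ∈ Mt s, ∀ y ∈ Mt t, (x + y) - c (s + t) = (x - c s) + (y - c t))
    (hc_comm : ∀ t ∈ Set.Icc (0 : H) u, ∀ x ∈ Mt t, x - c t = -(c t) + x) :
    IsSubalgebra v (c '' Set.Icc (0 : H) u) ∧
    Set.InjOn c (Set.Icc (0 : H) u) ∧
    c 0 = 0 ∧ c u = v ∧
    (∀ s ∈ Set.Icc (0 : H) u, ∀ t ∈ Set.Icc (0 : H) u,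
      c (min (s + t) u) = (c s + c t) ⊓ v) ∧
    (∀ t ∈ Set.Icc (0 : H) u, c (u - t) = v - c t) ∧
    (∀ t ∈ Set.Icc (0 : H) u, c (-t + u) = -(c t) + v) := by
  have h0 : (0 : H) ∈ Set.Icc (0 : H) u := ⟨le_rfl, hu.le⟩
  have huu : u ∈ Set.Icc (0 : H) u := ⟨hu.le, le_rfl⟩
  have hsub : ∀ t ∈ Set.Icc (0 : H) u, u - t ∈ Set.Icc (0 : H) u := fun t ht =>
    ⟨sub_nonneg.2 ht.2, sub_le_self u ht.1⟩
  have hneg : ∀ t ∈ Set.Icc (0 : H) u, -t + u ∈ Set.Icc (0 : H) u := fun t ht =>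
    ⟨le_neg_add_iff_add_le.2 (by simpa using ht.2),
      neg_add_le_iff_le_add.2 (le_add_of_nonneg_left ht.1)⟩
  have hc_Icc : ∀ t ∈ Set.Icc (0 : H) u, c t ∈ Set.Icc (0 : K) v := fun t ht =>
    hdec.subset_carrier t ht (hc_mem t ht)
  have hc_zero : c 0 = 0 := by
    have h := hc_add 0 h0 0 h0 (by simpa using hu.le)
    simpa using h
  have hsub_add : ∀ t ∈ Set.Icc (0 : H) u, c (u - t) + c t = v := fun t ht => by
    rw [← hc_add _ (hsub t ht) t ht (sub_add_cancel u t).le, sub_add_cancel, hc_u]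
  have hc_compl : ∀ t ∈ Set.Icc (0 : H) u, c (u - t) = v - c t := fun t ht =>
    eq_sub_of_add_eq (hsub_add t ht)
  have hc_sim : ∀ t ∈ Set.Icc (0 : H) u, c (-t + u) = -(c t) + v := fun t ht => by
    have h := hc_add t ht _ (hneg t ht) (add_neg_cancel_left t u).le
    rw [add_neg_cancel_left, hc_u] at h
    exact eq_neg_add_of_add_eq h.symm
  have hmin : ∀ s ∈ Set.Icc (0 : H) u, ∀ t ∈ Set.Icc (0 : H) u,
      min (s + t) u ∈ Set.Icc (0 : H) u := fun s hs t ht =>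
    ⟨le_min (add_nonneg hs.1 ht.1) hu.le, min_le_right _ _⟩
  have hc_oplus : ∀ s ∈ Set.Icc (0 : H) u, ∀ t ∈ Set.Icc (0 : H) u,
      c (min (s + t) u) = (c s + c t) ⊓ v := fun s hs t ht => by
    rcases le_or_gt (s + t) u with h | h
    · have hst := (hc_Icc _ ⟨add_nonneg hs.1 ht.1, h⟩).2
      rw [hc_add s hs t ht h] at hst
      rw [min_eq_left h, hc_add s hs t ht h, inf_eq_left.2 hst]
    · have hle : c (u - t) ≤ c s := hdec.le_of_lt _ (hsub t ht) s hs (sub_lt_iff_lt_add.2 h)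
        _ (hc_mem _ (hsub t ht)) _ (hc_mem s hs)
      have hv : v ≤ c s + c t := (hsub_add t ht).symm.le.trans (add_le_add_left hle _)
      rw [min_eq_right h.le, hc_u, inf_eq_right.2 hv]
  refine ⟨⟨?_, ⟨0, h0, hc_zero⟩, ⟨u, huu, hc_u⟩, ?_, ?_, ?_⟩, ?_, hc_zero, hc_u,
    hc_oplus, hc_compl, hc_sim⟩
  · rintro _ ⟨t, ht, rfl⟩
    exact hc_Icc t ht
  · rintro _ ⟨s, hs, rfl⟩ _ ⟨t, ht, rfl⟩
    exact ⟨_, hmin s hs t ht, hc_oplus s hs t ht⟩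
  · rintro _ ⟨t, ht, rfl⟩
    exact ⟨_, hsub t ht, hc_compl t ht⟩
  · rintro _ ⟨t, ht, rfl⟩
    exact ⟨_, hneg t ht, hc_sim t ht⟩
  · intro s hs t ht hst
    by_contra hne
    exact Set.disjoint_left.1 (hdec.pairwise_disjoint s hs t ht hne) (hc_mem s hs)
      (hst ▸ hc_mem t ht)
end Decomposition
end

section
/- Let M = Γ(K,v) be a pseudo MV-algebra and let I be an ideal of M such that I⁻ = I∼ (where I⁻ = {a⁻ : a ∈ I} and I∼ = {a∼ : a ∈ I}). Then I ∪ I⁻ is a subalgebra of M (it contains 0 and v and is closed under ⊕, ⁻ and ∼), and it is the smallest subalgebra of M containing I. -/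
open Pointwise

section Decomposition

variable {H : Type*} [AddGroup H] [LinearOrder H]
  [CovariantClass H H (· + ·) (· ≤ ·)]
  [CovariantClass H H (Function.swap (· + ·)) (· ≤ ·)]
variable {K : Type*} [AddGroup K] [Lattice K]
  [CovariantClass K K (· + ·) (· ≤ ·)]
  [CovariantClass K K (Function.swap (· + ·)) (· ≤ ·)]

/-- The set of right complements of an ideal is upward closed in `[0,v]`. -/
theorem IsIdeal.sub_image_of_le {v : K} {I : Set K} (hI : IsIdeal v I) {x z : K}
    (hx : x ∈ (fun a => v - a) '' I) (hxz : x ≤ z) (hzv : z ≤ v) :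
    z ∈ (fun a => v - a) '' I := by
  obtain ⟨a, ha, rfl⟩ := hx
  have hle : -z + v ≤ a := neg_add_le_iff_le_add.2 (sub_le_iff_le_add.1 hxz)
  have h0 : 0 ≤ -z + v := by
    have h := add_le_add_right hzv (-z)
    simpa using h
  exact ⟨-z + v, hI.2.2.1 _ ⟨h0, hle.trans (hI.2.1 ha).2⟩ a ha hle, by simp⟩

/-- The set of left complements of an ideal is upward closed in `[0,v]`. -/
theorem IsIdeal.neg_add_image_of_le {v : K} {I : Set K} (hI : IsIdeal v I) {x z : K}
    (hx : x ∈ (fun a => -a + v) '' I) (hxz : x ≤ z) (hzv : z ≤ v) :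
    z ∈ (fun a => -a + v) '' I := by
  obtain ⟨a, ha, rfl⟩ := hx
  have hle : v - z ≤ a := sub_le_iff_le_add.2 (neg_add_le_iff_le_add.1 hxz)
  exact ⟨v - z, hI.2.2.1 _ ⟨sub_nonneg.2 hzv, hle.trans (hI.2.1 ha).2⟩ a ha hle, by simp⟩

/-- Let `M = Γ(K,v)` be a pseudo MV-algebra and `I` an ideal of `M`
with `I⁻ = I∼` (where `I⁻ = {v - a : a ∈ I}` and `I∼ = {-a + v : a ∈ I}`). Then
`I ∪ I⁻` is a subalgebra of `M`, and it is the smallest subalgebra of `M`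
containing `I`. -/
theorem statement_13 (v : K) (hsuK : IsStrongOrderUnit v)
    (I : Set K) (hI : IsIdeal v I)
    (hsym : (fun a => v - a) '' I = (fun a => -a + v) '' I) :
    IsSubalgebra v (I ∪ (fun a => v - a) '' I) ∧
    ∀ S : Set K, IsSubalgebra v S → I ⊆ S → I ∪ (fun a => v - a) '' I ⊆ S := by
  have hM : I ∪ (fun a => v - a) '' I ⊆ Set.Icc (0 : K) v := by
    rintro x (hx | ⟨a, ha, rfl⟩)
    · exact hI.2.1 hx
    · exact ⟨sub_nonneg.2 (hI.2.1 ha).2, sub_le_self v (hI.2.1 ha).1⟩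
  have hzero : (0 : K) ∈ I := by
    obtain ⟨b, hb⟩ := hI.1
    exact hI.2.2.1 0 ⟨le_rfl, hsuK.1⟩ b hb (hI.2.1 hb).1
  refine ⟨⟨hM, Or.inl hzero, Or.inr ⟨0, hzero, sub_zero v⟩, ?_, ?_, ?_⟩, ?_⟩
  · rintro x (hxI | hxI) y hy
    · rcases id hy with hyI | hyI
      · exact Or.inl (hI.2.2.2 x hxI y hyI)
      · have hle : y ≤ (x + y) ⊓ v :=
          le_inf (le_add_of_nonneg_left (hI.2.1 hxI).1) (hM hy).2
        rw [hsym] at hyI ⊢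
        exact Or.inr (hI.neg_add_image_of_le hyI hle inf_le_right)
    · have hle : x ≤ (x + y) ⊓ v :=
        le_inf (le_add_of_nonneg_right (hM hy).1) (hM (Or.inr hxI)).2
      exact Or.inr (hI.sub_image_of_le hxI hle inf_le_right)
  · rintro x (hx | hx)
    · exact Or.inr ⟨x, hx, rfl⟩
    · rw [hsym] at hx
      obtain ⟨b, hb, rfl⟩ := hx
      exact Or.inl (by simpa [sub_eq_add_neg] using hb)
  · rintro x (hx | ⟨a, ha, rfl⟩)
    · rw [hsym]
      exact Or.inr ⟨x, hx, rfl⟩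
    · exact Or.inl (by simpa using ha)
  · rintro S hS hIS x (hx | ⟨a, ha, rfl⟩)
    · exact hIS hx
    · exact hS.2.2.2.2.1 a (hIS ha)
end Decomposition
end

section
/- Let H be a linearly ordered group with strong unit u > 0 and let G, G' be ℓ-groups. Let f : Γ(H ×lex G, (u,0)) → Γ(H ×lex G', (u,0)) be a homomorphism of pseudo MV-algebras such that f(t,0) = (t,0) for every t ∈ [0,u]_H and f({(0,g) : g ∈ G⁺}) ⊆ {(0,g') : g' ∈ G'⁺}. Then there exists a unique ℓ-group homomorphism h : G → G' such that f(t,g) = (t, h(g)) for every (t,g) ∈ Γ(H ×lex G, (u,0)). -/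
theorem map_posPart_sub_map_negPart {A B : Type*} [AddGroup A] [Lattice A]
    [CovariantClass A A (· + ·) (· ≤ ·)]
    [CovariantClass A A (Function.swap (· + ·)) (· ≤ ·)] [AddGroup B] {k : A → B}
    (hk : ∀ a b : A, 0 ≤ a → 0 ≤ b → k (a + b) = k a + k b) {a b : A}
    (ha : 0 ≤ a) (hb : 0 ≤ b) :
    k (a - b)⁺ - k (a - b)⁻ = k a - k b := by
  have hd : (a - b)⁺ - (a - b)⁻ = a - b := posPart_sub_negPart (a - b)
  have hc : -(a - b)⁺ + a = -(a - b)⁻ + b := by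
    have h1 : a = (a - b)⁺ - (a - b)⁻ + b := by rw [hd]; simp
    calc -(a - b)⁺ + a = -(a - b)⁺ + ((a - b)⁺ - (a - b)⁻ + b) := by rw [← h1]
      _ = _ := by simp [sub_eq_add_neg, add_assoc]
  have hle : (a - b)⁺ ≤ a := sup_le (sub_le_self a hb) ha
  have hc0 : 0 ≤ -(a - b)⁺ + a := le_neg_add_iff_le.mpr hle
  have h1 := hk _ _ (posPart_nonneg (a - b)) hc0
  have h2 := hk _ _ (negPart_nonneg (a - b)) hc0
  rw [add_neg_cancel_left] at h1
  rw [hc, add_neg_cancel_left] at h2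
  rw [h1, h2, hc]
  simp [sub_eq_add_neg, add_assoc]

/-- A map between ℓ-groups that is additive on the positive cone and preserves truncated
differences there extends to an ℓ-group homomorphism. -/
theorem exists_latticeGroupHom_extending {A B : Type*} [AddGroup A] [Lattice A]
    [CovariantClass A A (· + ·) (· ≤ ·)]
    [CovariantClass A A (Function.swap (· + ·)) (· ≤ ·)] [AddGroup B] [Lattice B]
    [CovariantClass B B (· + ·) (· ≤ ·)]
    [CovariantClass B B (Function.swap (· + ·)) (· ≤ ·)] (k : A → B)
    (hk : ∀ a b : A, 0 ≤ a → 0 ≤ b → k (a + b) = k a + k b)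
    (hs : ∀ a b : A, 0 ≤ a → 0 ≤ b → k ((a - b) ⊔ 0) = (k a - k b) ⊔ 0) :
    ∃ h : A → B, (∀ a b, h (a + b) = h a + h b) ∧ (∀ a b, h (a ⊓ b) = h a ⊓ h b) ∧
      (∀ a b, h (a ⊔ b) = h a ⊔ h b) ∧ ∀ a, 0 ≤ a → h a = k a := by
  have hk0 : k 0 = 0 := by simpa using hk 0 0 le_rfl le_rfl
  let h : A → B := fun g => k g⁺ - k g⁻
  have hsub : ∀ a b, 0 ≤ a → 0 ≤ b → h (a - b) = k a - k b := fun a b ha hb =>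
    map_posPart_sub_map_negPart hk ha hb
  have hpos : ∀ a, 0 ≤ a → h a = k a := fun a ha => by
    simpa [hk0] using hsub a 0 ha le_rfl
  have hadd : ∀ x y, h (x + y) = h x + h y := by
    intro x y
    have hz := posPart_sub_negPart (-x⁻ + y⁺)
    have e1 : y⁺ + (-x⁻ + y⁺)⁻ = x⁻ + (-x⁻ + y⁺)⁺ := by
      rw [sub_eq_iff_eq_add] at hz
      rw [hz]
      simp [add_assoc]
    have e2 : k y⁺ + k (-x⁻ + y⁺)⁻ = k x⁻ + k (-x⁻ + y⁺)⁺ := by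
      rw [← hk _ _ (posPart_nonneg _) (negPart_nonneg _), e1,
        hk _ _ (negPart_nonneg _) (posPart_nonneg _)]
    have e3 : k (-x⁻ + y⁺)⁺ - k (-x⁻ + y⁺)⁻ = -k x⁻ + k y⁺ := by
      rw [sub_eq_iff_eq_add, add_assoc, e2, neg_add_cancel_left]
    have e4 : x + y = (x⁺ + (-x⁻ + y⁺)⁺) - (y⁻ + (-x⁻ + y⁺)⁻) := by
      calc x + y = (x⁺ - x⁻) + (y⁺ - y⁻) := by
            rw [posPart_sub_negPart, posPart_sub_negPart]
        _ = x⁺ + (-x⁻ + y⁺) - y⁻ := by simp [sub_eq_add_neg, add_assoc]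
        _ = x⁺ + ((-x⁻ + y⁺)⁺ - (-x⁻ + y⁺)⁻) - y⁻ := by rw [hz]
        _ = _ := by simp [sub_eq_add_neg, add_assoc]
    rw [e4, hsub _ _ (add_nonneg (posPart_nonneg _) (posPart_nonneg _))
      (add_nonneg (negPart_nonneg _) (negPart_nonneg _)),
      hk _ _ (posPart_nonneg _) (posPart_nonneg _),
      hk _ _ (negPart_nonneg _) (negPart_nonneg _)]
    calc k x⁺ + k (-x⁻ + y⁺)⁺ - (k y⁻ + k (-x⁻ + y⁺)⁻)
        = k x⁺ + (k (-x⁻ + y⁺)⁺ - k (-x⁻ + y⁺)⁻) - k y⁻ := by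
          simp [sub_eq_add_neg, add_assoc]
      _ = h x + h y := by rw [e3]; simp [h, sub_eq_add_neg, add_assoc]
  have hneg : ∀ a, h (-a) = -h a := fun a =>
    eq_neg_of_add_eq_zero_left (by rw [← hadd, neg_add_cancel, hpos 0 le_rfl, hk0])
  have hsup0 : ∀ a, h (a ⊔ 0) = h a ⊔ 0 := by
    intro a
    have := hs _ _ (posPart_nonneg a) (negPart_nonneg a)
    rw [posPart_sub_negPart] at this
    rw [hpos _ le_sup_right, this]
  have hsup : ∀ a b, h (a ⊔ b) = h a ⊔ h b := by
    intro a b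
    have e : a ⊔ b = ((a - b) ⊔ 0) + b := by rw [sup_add]; simp
    rw [e, hadd, hsup0, sup_add, zero_add, ← hadd, sub_add_cancel]
  refine ⟨h, hadd, fun a b => ?_, hsup, hpos⟩
  rw [← neg_neg (a ⊓ b), neg_inf, hneg, hsup, hneg, hneg, neg_sup, neg_neg, neg_neg]

section LexGroup

variable {H : Type*} [AddGroup H] [LinearOrder H]
  [CovariantClass H H (· + ·) (· ≤ ·)]
  [CovariantClass H H (Function.swap (· + ·)) (· ≤ ·)]
variable {G : Type*} [AddGroup G] [Lattice G]
  [CovariantClass G G (· + ·) (· ≤ ·)]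
  [CovariantClass G G (Function.swap (· + ·)) (· ≤ ·)]
variable {G' : Type*} [AddGroup G'] [Lattice G']
  [CovariantClass G' G' (· + ·) (· ≤ ·)]
  [CovariantClass G' G' (Function.swap (· + ·)) (· ≤ ·)]

/-- Let `H` be a linearly ordered group with strong unit `u > 0`, `G`, `G'`
ℓ-groups, and `f : Γ(H ×lex G, (u,0)) → Γ(H ×lex G', (u,0))` a homomorphism of pseudo
MV-algebras such that `f (t,0) = (t,0)` for every `t ∈ [0,u]_H` and
`f({(0,g) : g ∈ G⁺}) ⊆ {(0,g') : g' ∈ G'⁺}`. Then there is a unique ℓ-group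
homomorphism `h : G → G'` with `f (t,g) = (t, h g)` for all `(t,g)` in the interval. -/
theorem statement_14 (u : H) (hu : 0 < u) (hsu : IsStrongOrderUnit u)
    (f : H × G → H × G')
    (hmap : ∀ p : H × G, lexLe 0 p → lexLe p ((u, 0) : H × G) →
      lexLe (0 : H × G') (f p) ∧ lexLe (f p) ((u, 0) : H × G'))
    (hzero : f 0 = 0) (hone : f ((u, 0) : H × G) = ((u, 0) : H × G'))
    (hoplus : ∀ p q : H × G, lexLe 0 p → lexLe p ((u, 0) : H × G) →
      lexLe 0 q → lexLe q ((u, 0) : H × G) →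
      f (lexInf (p + q) ((u, 0) : H × G)) = lexInf (f p + f q) ((u, 0) : H × G'))
    (hcompl : ∀ p : H × G, lexLe 0 p → lexLe p ((u, 0) : H × G) →
      f (((u, 0) : H × G) - p) = ((u, 0) : H × G') - f p)
    (hsim : ∀ p : H × G, lexLe 0 p → lexLe p ((u, 0) : H × G) →
      f (-p + ((u, 0) : H × G)) = -(f p) + ((u, 0) : H × G'))
    (hfix : ∀ t ∈ Set.Icc (0 : H) u, f ((t, 0) : H × G) = ((t, 0) : H × G'))
    (hker : ∀ g : G, 0 ≤ g → ∃ g' : G', 0 ≤ g' ∧ f ((0, g) : H × G) = ((0, g') : H × G')) :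
    ∃! h : G → G',
      (∀ a b : G, h (a + b) = h a + h b) ∧
      (∀ a b : G, h (a ⊓ b) = h a ⊓ h b) ∧
      (∀ a b : G, h (a ⊔ b) = h a ⊔ h b) ∧
      ∀ p : H × G, lexLe 0 p → lexLe p ((u, 0) : H × G) → f p = (p.1, h p.2) := by
  have hu0 : ∀ {s : H}, s ≤ u → 0 ≤ s → s = u ∨ s = 0 ∨ (0 < s ∧ s < u) := by
    intro s h1 h2
    rcases h1.eq_or_lt with h | h
    · exact Or.inl h
    · rcases h2.eq_or_lt with h' | h'
      · exact Or.inr (Or.inl h'.symm)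
      · exact Or.inr (Or.inr ⟨h', h⟩)
  obtain ⟨k, hk⟩ : ∃ k : G → G', ∀ g, 0 ≤ g → f (0, g) = (0, k g) := by
    refine ⟨fun g => (f (0, g)).2, fun g hg => ?_⟩
    obtain ⟨g', -, h⟩ := hker g hg
    simp [h]
  have low : ∀ g : G, 0 ≤ g → lexLe 0 ((0, g) : H × G) ∧ lexLe ((0, g) : H × G) (u, 0) :=
    fun g hg => ⟨Or.inr ⟨rfl, hg⟩, Or.inl hu⟩
  have top : ∀ g : G, 0 ≤ g → lexLe 0 ((u, -g) : H × G) ∧ lexLe ((u, -g) : H × G) (u, 0) :=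
    fun g hg => ⟨Or.inl hu, Or.inr ⟨rfl, neg_nonpos.mpr hg⟩⟩
  have mid : ∀ (t : H) (g : G), 0 < t → t < u →
      lexLe 0 ((t, g) : H × G) ∧ lexLe ((t, g) : H × G) (u, 0) :=
    fun t g h1 h2 => ⟨Or.inl h1, Or.inl h2⟩
  have ftop : ∀ g : G, 0 ≤ g → f (u, -g) = (u, -k g) := by
    intro g hg
    have := hcompl _ (low g hg).1 (low g hg).2
    rw [hk g hg] at this
    simpa [Prod.mk_sub_mk] using this
  have kadd : ∀ a b : G, 0 ≤ a → 0 ≤ b → k (a + b) = k a + k b := by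
    intro a b ha hb
    have := hoplus _ _ (low a ha).1 (low a ha).2 (low b hb).1 (low b hb).2
    rw [hk a ha, hk b hb] at this
    simpa [lexInf, hu, hk _ (add_nonneg ha hb)] using this
  have ksub : ∀ a b : G, 0 ≤ a → 0 ≤ b → k ((a - b) ⊔ 0) = (k a - k b) ⊔ 0 := by
    intro a b ha hb
    have := hoplus _ _ (low b hb).1 (low b hb).2 (top a ha).1 (top a ha).2
    rw [hk b hb, ftop a ha] at this
    have e : (b + -a) ⊓ 0 = -((a - b) ⊔ 0) := by
      rw [neg_sup, neg_sub, neg_zero, sub_eq_add_neg]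
    simp only [lexInf, Prod.mk_add_mk, zero_add, lt_irrefl, if_false] at this
    rw [e, ftop _ le_sup_right] at this
    rw [← neg_inj, (Prod.mk.inj this).2, neg_sup, neg_sub, neg_zero, sub_eq_add_neg]
  obtain ⟨h, hadd, hinf, hsup, hpos⟩ := exists_latticeGroupHom_extending k kadd ksub
  have hneg : ∀ a, h (-a) = -h a := (AddMonoidHom.mk' h hadd).map_neg
  have fmidneg : ∀ (t : H) (g : G), 0 < t → t < u → 0 ≤ g → f (t, -g) = (t, -k g) := by
    intro t g h1 h2 hg
    have := hoplus _ _ (mid t (-g) h1 h2).1 (mid t (-g) h1 h2).2 (low g hg).1 (low g hg).2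
    rw [hk g hg] at this
    rcases hp : f (t, -g) with ⟨s, x⟩
    rw [hp] at this
    simp only [lexInf, Prod.mk_add_mk, add_zero, neg_add_cancel, h2, if_true,
      hfix t ⟨h1.le, h2.le⟩] at this
    split_ifs at this with c1 c2
    · obtain ⟨rfl, h4⟩ := Prod.mk.inj this
      rw [eq_neg_of_add_eq_zero_left h4.symm]
    · exact absurd (Prod.mk.inj this).1 h2.ne
    · obtain ⟨rfl, -⟩ := Prod.mk.inj this
      exact absurd h2 c1
  refine ⟨h, ⟨hadd, hinf, hsup, ?_⟩, ?_⟩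
  · rintro ⟨t, g⟩ hp0 hpu
    have ht0 : 0 ≤ t := hp0.elim (fun h => h.le) (fun h => h.1.le)
    have htu : t ≤ u := hpu.elim (fun h => h.le) (fun h => h.1.le)
    rcases hu0 htu ht0 with rfl | rfl | ⟨h1, h2⟩
    · have hg : g ≤ 0 := hpu.elim (fun h => absurd h (lt_irrefl _)) (fun h => h.2)
      have hg' := neg_nonneg.mpr hg
      simpa [← hpos _ hg', hneg] using ftop (-g) hg'
    · have hg : 0 ≤ g := hp0.elim (fun h => absurd h (lt_irrefl _)) (fun h => h.2)
      simp [hk g hg, hpos g hg]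
    · have hn := negPart_nonneg g
      have hq := posPart_nonneg g
      have e : -g⁻ + g⁺ = g := by
        rw [neg_add_eq_iff_eq_add, negPart_def, posPart_def, sup_add, neg_add_cancel, zero_add,
          sup_comm]
      have := hoplus _ _ (mid t (-g⁻) h1 h2).1 (mid t (-g⁻) h1 h2).2 (low g⁺ hq).1 (low g⁺ hq).2
      rw [hk _ hq, fmidneg t _ h1 h2 hn] at this
      simp only [lexInf, Prod.mk_add_mk, add_zero, h2, if_true, e] at this
      rw [this, ← hpos _ hn, ← hpos _ hq, ← hneg, ← hadd, e]
  · rintro h' ⟨hadd', -, -, hf'⟩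
    have hp' : ∀ g, 0 ≤ g → h' g = h g := by
      intro g hg
      have := hf' _ (low g hg).1 (low g hg).2
      rw [hk g hg] at this
      rw [hpos g hg, (Prod.mk.inj this).2]
    funext g
    have hsub : ∀ a b, h' (a - b) = h' a - h' b := (AddMonoidHom.mk' h' hadd').map_sub
    have hsub0 : ∀ a b, h (a - b) = h a - h b := (AddMonoidHom.mk' h hadd).map_sub
    rw [← posPart_sub_negPart g, hsub, hsub0, hp' _ (posPart_nonneg g), hp' _ (negPart_nonneg g)]

end LexGroup
end

section
/- Let H be a linearly ordered group with strong unit u > 0, let G, G' be ℓ-groups, let h : G → G' be an ℓ-group homomorphism, and let f : Γ(H ×lex G, (u,0)) → Γ(H ×lex G', (u,0)) be the induced homomorphism of pseudo MV-algebras given by f(t,g) = (t, h(g)). Then: (i) if f is surjective, so is h; (ii) if f is injective, so is h. -/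
section PositiveCone

variable {A : Type*} [AddGroup A] [Lattice A]
  [CovariantClass A A (· + ·) (· ≤ ·)]

/-- Every element of an ℓ-group is the difference of its positive and negative parts. -/
theorem sup_zero_sub_neg_sup_zero (y : A) : y ⊔ 0 - (-y ⊔ 0) = y := by
  have key : y ⊔ 0 = y + (-y ⊔ 0) := by
    rw [add_sup, add_neg_cancel, add_zero, sup_comm]
  rw [key, add_sub_cancel_right]

end PositiveCone

/-- An additive map between ℓ-groups is surjective as soon as its image contains the
positive cone. -/
theorem surjective_of_forall_nonneg {A B : Type*} [AddGroup A] [AddGroup B] [Lattice B]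
    [CovariantClass B B (· + ·) (· ≤ ·)] (k : A →+ B)
    (hk : ∀ y : B, 0 ≤ y → ∃ x, k x = y) : Function.Surjective k := by
  intro y
  obtain ⟨a, ha⟩ := hk (y ⊔ 0) le_sup_right
  obtain ⟨b, hb⟩ := hk (-y ⊔ 0) le_sup_right
  exact ⟨a - b, by rw [map_sub, ha, hb, sup_zero_sub_neg_sup_zero]⟩

/-- An additive map between ℓ-groups preserving joins is injective as soon as it has trivial
kernel on the positive cone. -/
theorem injective_of_forall_nonneg {A B : Type*} [AddGroup A] [Lattice A]
    [CovariantClass A A (· + ·) (· ≤ ·)] [AddGroup B] [Lattice B] (k : A →+ B)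
    (hsup : ∀ a b : A, k (a ⊔ b) = k a ⊔ k b)
    (hk : ∀ x : A, 0 ≤ x → k x = 0 → x = 0) : Function.Injective k := by
  rw [injective_iff_map_eq_zero]
  intro x hx
  have hpos : x ⊔ 0 = 0 := hk _ le_sup_right (by rw [hsup, hx, map_zero, sup_idem])
  have hneg : -x ⊔ 0 = 0 :=
    hk _ le_sup_right (by rw [hsup, map_neg, hx, map_zero, neg_zero, sup_idem])
  rw [← sup_zero_sub_neg_sup_zero x, hpos, hneg, sub_zero]

section LexGroup

variable {H : Type*} [AddGroup H] [LinearOrder H]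
  [CovariantClass H H (· + ·) (· ≤ ·)]
  [CovariantClass H H (Function.swap (· + ·)) (· ≤ ·)]
variable {G : Type*} [AddGroup G] [Lattice G]
  [CovariantClass G G (· + ·) (· ≤ ·)]
  [CovariantClass G G (Function.swap (· + ·)) (· ≤ ·)]
variable {G' : Type*} [AddGroup G'] [Lattice G']
  [CovariantClass G' G' (· + ·) (· ≤ ·)]
  [CovariantClass G' G' (Function.swap (· + ·)) (· ≤ ·)]

/-- Let `H` be a linearly ordered group with strong unit `u > 0`, `G`, `G'`
ℓ-groups, `h : G → G'` an ℓ-group homomorphism, and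
`f : Γ(H ×lex G, (u,0)) → Γ(H ×lex G', (u,0))` the induced homomorphism of pseudo
MV-algebras, `f (t,g) = (t, h g)`. Then (i) if `f` is surjective (onto the interval),
so is `h`; (ii) if `f` is injective (on the interval), so is `h`. -/
theorem statement_15 (u : H) (hu : 0 < u) (hsu : IsStrongOrderUnit u)
    (h : G → G')
    (hadd : ∀ a b : G, h (a + b) = h a + h b)
    (hinf : ∀ a b : G, h (a ⊓ b) = h a ⊓ h b)
    (hsup : ∀ a b : G, h (a ⊔ b) = h a ⊔ h b)
    (f : H × G → H × G') (hf : ∀ p : H × G, f p = (p.1, h p.2)) :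
    ((∀ q : H × G', lexLe 0 q → lexLe q ((u, 0) : H × G') →
        ∃ p : H × G, lexLe 0 p ∧ lexLe p ((u, 0) : H × G) ∧ f p = q) →
      Function.Surjective h) ∧
    ((∀ p q : H × G, lexLe 0 p → lexLe p ((u, 0) : H × G) →
        lexLe 0 q → lexLe q ((u, 0) : H × G) → f p = f q → p = q) →
      Function.Injective h) := by
  let k : G →+ G' := AddMonoidHom.mk' h hadd
  constructor
  · intro hsurj
    refine surjective_of_forall_nonneg k fun y hy => ?_
    obtain ⟨p, -, -, hp⟩ := hsurj (0, y) (Or.inr ⟨rfl, hy⟩) (Or.inl hu)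
    rw [hf] at hp
    exact ⟨p.2, congrArg Prod.snd hp⟩
  · intro hinj
    refine injective_of_forall_nonneg k hsup fun x hx hkx => ?_
    have hfx : f (0, x) = f (0, 0) := by
      rw [hf, hf]
      exact congrArg (Prod.mk 0) (hkx.trans (map_zero k).symm)
    exact congrArg Prod.snd
      (hinj (0, x) (0, 0) (Or.inr ⟨rfl, hx⟩) (Or.inl hu) (Or.inr ⟨rfl, le_rfl⟩) (Or.inl hu) hfx)

end LexGroup
end

section
/- Let H be a linearly ordered group with strong unit u > 0 and let M = Γ(K,v) be a weakly (H,u)-perfect pseudo MV-algebra with (H,u)-decomposition (M_t : t ∈ [0,u]_H) and elements (c_t : t ∈ [0,u]_H). Set b = v − c_u (computed in K). Then b ≥ 0, v − c_u = −c_u + v, and c_t + b = b + c_t for every t ∈ [0,u]_H. -/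
open Pointwise

section Decomposition

variable {H : Type*} [AddGroup H] [LinearOrder H]
  [CovariantClass H H (· + ·) (· ≤ ·)]
  [CovariantClass H H (Function.swap (· + ·)) (· ≤ ·)]
variable {K : Type*} [AddGroup K] [Lattice K]
  [CovariantClass K K (· + ·) (· ≤ ·)]
  [CovariantClass K K (Function.swap (· + ·)) (· ≤ ·)]

/-- Let `M = Γ(K,v)` be weakly `(H,u)`-perfect with decomposition
`(Mt t)` and elements `(c t)`, and set `b = v - c u` (computed in `K`). Then `b ≥ 0`,
`v - c u = -(c u) + v`, and `c t + b = b + c t` for every `t ∈ [0,u]_H`. -/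
theorem statement_18 (u : H) (v : K) (hu : 0 < u)
    (hsuH : IsStrongOrderUnit u) (hsuK : IsStrongOrderUnit v)
    (Mt : H → Set K) (c : H → K)
    (hdec : IsHuDecomposition u v Mt)
    (hc_mem : ∀ t ∈ Set.Icc (0 : H) u, c t ∈ Mt t)
    (hc_add : ∀ s ∈ Set.Icc (0 : H) u, ∀ t ∈ Set.Icc (0 : H) u, s + t ≤ u →
      c (s + t) = c s + c t)
    (hc_lex : ∀ s ∈ Set.Icc (0 : H) u, ∀ t ∈ Set.Icc (0 : H) u, s + t ≤ u →
      ∀ x ∈ Mt s, ∀ y ∈ Mt t, (x + y) - c (s + t) = (x - c s) + (y - c t))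
    (hc_comm : ∀ t ∈ Set.Icc (0 : H) u, ∀ x ∈ Mt t, x - c t = -(c t) + x)
    (b : K) (hbdef : b = v - c u) :
    0 ≤ b ∧ v - c u = -(c u) + v ∧
    ∀ t ∈ Set.Icc (0 : H) u, c t + b = b + c t := by
  have h0 : (0 : H) ∈ Set.Icc (0 : H) u := ⟨le_rfl, hu.le⟩
  have huu : u ∈ Set.Icc (0 : H) u := ⟨hu.le, le_rfl⟩
  have hc0 : c 0 = 0 := by
    have h := hc_add 0 h0 0 h0 (by simpa using hu.le)
    simpa using h
  have hv : v ∈ Mt u := by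
    have h : v - c 0 ∈ Mt (u - 0) := by
      rw [← hdec.compl_image 0 h0]
      exact ⟨c 0, hc_mem 0 h0, rfl⟩
    simpa [hc0] using h
  refine ⟨?_, hc_comm u huu v hv, fun t ht => ?_⟩
  · have h := (hdec.subset_carrier u huu (hc_mem u huu)).2
    rw [hbdef]
    exact sub_nonneg.mpr h
  · have hr : -t + u ∈ Set.Icc (0 : H) u := by
      constructor
      · have h := add_le_add_right ht.2 (-t)
        simpa using h
      · have h := add_le_add_left (neg_nonpos.mpr ht.1) u
        simpa using h
    have htr : t + (-t + u) = u := by simp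
    have hy : -(c t) + v ∈ Mt (-t + u) := by
      rw [← hdec.sim_image t ht]
      exact ⟨c t, hc_mem t ht, rfl⟩
    have hcu := hc_add t ht _ hr htr.le
    have hlex := hc_lex t ht _ hr htr.le (c t) (hc_mem t ht) _ hy
    rw [htr] at hcu hlex
    have hcr : c (-t + u) = -(c t) + c u := by simp [hcu]
    rw [add_neg_cancel_left, sub_self, zero_add, hcr, ← hbdef] at hlex
    have hb : c t + b = v + (-(c u) + c t) := by
      simpa [sub_eq_add_neg, add_assoc] using congrArg (c t + ·) hlex
    rw [hb, hbdef, sub_eq_add_neg, add_assoc]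
end Decomposition
end

section
/- Let G be a (not necessarily abelian) ℓ-group with strong unit u. Then the pseudo MV-algebra Γ(G,u) is symmetric (i.e. u − x = −x + u for every x with 0 ≤ x ≤ u) if and only if u belongs to the commutative center C(G) of G, i.e. u + g = g + u for every g ∈ G. -/
/-- If `u ≥ 0` commutes with every element of the interval `[0, u]` of an ℓ-group, then it
commutes with every element of `[0, n • u]`. -/
theorem addCommute_of_le_nsmul {G : Type*} [AddGroup G] [Lattice G]
    [AddLeftMono G] [AddRightMono G] {u : G} (hu : 0 ≤ u)
    (h : ∀ x : G, 0 ≤ x → x ≤ u → AddCommute u x) (n : ℕ) :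
    ∀ g : G, 0 ≤ g → g ≤ n • u → AddCommute u g := by
  induction n with
  | zero =>
    intro g hg hgn
    rw [zero_nsmul] at hgn
    exact le_antisymm hgn hg ▸ AddCommute.zero_right u
  | succ n ih =>
    intro g hg hgn
    have hy : AddCommute u (-(g ⊓ u) + g) := by
      apply ih
      · rw [le_neg_add_iff_add_le, add_zero]
        exact inf_le_left
      · rw [neg_inf, ← le_add_neg_iff_add_le]
        refine sup_le ?_ ?_
        · rw [le_add_neg_iff_add_le, neg_add_cancel]
          exact nsmul_nonneg hu n
        · rw [le_add_neg_iff_add_le, neg_add_le_iff_le_add, ← succ_nsmul']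
          exact hgn
    simpa using (h (g ⊓ u) (le_inf hg hu) inf_le_right).add_right hy

/-- Let `G` be a (not necessarily abelian) ℓ-group with strong unit `u`.
The pseudo MV-algebra `Γ(G,u)` is symmetric (`x⁻ = x∼`, i.e. `u - x = -x + u` for all
`0 ≤ x ≤ u`) if and only if `u` lies in the commutative center of `G`, i.e.
`u + g = g + u` for every `g ∈ G`. -/
theorem statement_19 {G : Type*} [AddGroup G] [Lattice G]
    [CovariantClass G G (· + ·) (· ≤ ·)]
    [CovariantClass G G (Function.swap (· + ·)) (· ≤ ·)]
    (u : G) (hsu : IsStrongOrderUnit u) :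
    (∀ x : G, 0 ≤ x → x ≤ u → u - x = -x + u) ↔ (∀ g : G, u + g = g + u) := by
  refine ⟨fun h g => ?_, fun h x _ _ => ?_⟩
  · obtain ⟨hu, hunit⟩ := hsu
    have hcomm : ∀ x : G, 0 ≤ x → x ≤ u → AddCommute u x := fun x h0 hx => by
      have hxu := h x h0 hx
      rw [sub_eq_iff_eq_add, add_assoc, eq_neg_add_iff_add_eq] at hxu
      exact hxu.symm
    obtain ⟨m, -, hm⟩ := hunit (-g)
    obtain ⟨n, -, hn⟩ := hunit (g + m • u)
    have hgm : AddCommute u (g + m • u) :=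
      addCommute_of_le_nsmul hu hcomm n _ (neg_le_iff_add_nonneg'.mp hm) hn
    have hg := hgm.add_right ((AddCommute.refl u).nsmul_right m).neg_right
    rw [add_neg_cancel_right] at hg
    exact hg.eq
  · rw [sub_eq_add_neg]
    exact h (-x)
end
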